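/- Every smooth 3-dimensional lattice prismatoid has a unimodular cover. Concretely: if Q1, Q2 ⊂ ℝ^2 are lattice polygons, k is a positive integer, and P = conv(Q1×{0} ∪ Q2×{k}) ⊂ ℝ^3 is a smooth lattice 3-polytope, then P has a unimodular cover. -/

import Mathlib

open scoped Pointwise

noncomputable section

/-- The real point corresponding to an integer point of `ℤ³`. -/
def toR3 (v : Fin 3 → ℤ) : Fin 3 → ℝ := fun i => (v i : ℝ)

/-- The real point corresponding to an integer point of `ℤ²`. -/
def toR2 (v : Fin 2 → ℤ) : Fin 2 → ℝ := fun i => (v i : ℝ)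

/-- A unimodular tetrahedron: the convex hull of lattice points `v0, v1, v2, v3`
such that `v1 - v0, v2 - v0, v3 - v0` form a `ℤ`-basis of `ℤ³`. -/
def IsUnimodularTet (S : Set (Fin 3 → ℝ)) : Prop :=
  ∃ v : Fin 4 → Fin 3 → ℤ,
    S = convexHull ℝ {toR3 (v 0), toR3 (v 1), toR3 (v 2), toR3 (v 3)} ∧
    (Matrix.of ![v 1 - v 0, v 2 - v 0, v 3 - v 0]).det ∈ ({1, -1} : Set ℤ)

/-- A unimodular cover of `P`. -/
def HasUnimodularCover (P : Set (Fin 3 → ℝ)) : Prop :=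
  ∃ 𝒞 : Set (Set (Fin 3 → ℝ)),
    (∀ S ∈ 𝒞, IsUnimodularTet S ∧ S ⊆ P) ∧ ⋃₀ 𝒞 = P

/-- A lattice polytope in `ℝ²`: the convex hull of a nonempty finite set of
lattice points. -/
def IsLatticePolytope2 (P : Set (Fin 2 → ℝ)) : Prop :=
  ∃ V : Finset (Fin 2 → ℤ), V.Nonempty ∧ P = convexHull ℝ (toR2 '' ↑V)

/-- A vertex of a polytope `P` is an extreme point of `P`. -/
def IsVertex (P : Set (Fin 3 → ℝ)) (v : Fin 3 → ℝ) : Prop :=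
  v ∈ Set.extremePoints ℝ P

/-- `[v,w]` is an edge of the polytope `P`: a one-dimensional extreme face. -/
def IsEdge (P : Set (Fin 3 → ℝ)) (v w : Fin 3 → ℝ) : Prop :=
  v ≠ w ∧ IsExtreme ℝ P (segment ℝ v w)

/-- A primitive lattice vector: the gcd of its coordinates is `1`. -/
def IsPrimitive3 (d : Fin 3 → ℤ) : Prop :=
  Int.gcd (d 0) (Int.gcd (d 1) (d 2)) = 1

/-- A lattice 3-polytope is smooth if it is simple (every vertex lies on exactly
3 edges) and at each vertex the primitive lattice vectors in the directions of
the three edges form a `ℤ`-basis of `ℤ³`. -/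
def IsSmooth (P : Set (Fin 3 → ℝ)) : Prop :=
  ∀ v, IsVertex P v →
    ∃ w : Fin 3 → Fin 3 → ℝ, Function.Injective w ∧
      {x | IsEdge P v x} = {w 0, w 1, w 2} ∧
      ∃ d : Fin 3 → Fin 3 → ℤ,
        (∀ i, IsPrimitive3 (d i) ∧ ∃ t : ℝ, 0 < t ∧ w i - v = t • toR3 (d i)) ∧
        (Matrix.of ![d 0, d 1, d 2]).det ∈ ({1, -1} : Set ℤ)


set_option maxHeartbeats 2000000 in
theorem NL (m c s1 s2 DX DY X0 Y0 : ℝ) (hm : 2 ≤ m) (hc1 : 1 ≤ c) (hc2 : c ≤ m - 1)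
    (hs : 0 ≤ s1 + s2)
    (h1 : -s1 * c < 1) (h2 : s1 * (m - c) < 1) (h3 : -s2 * (m - c) < 1) (h4 : s2 * c < 1)
    (hD1 : m + DX ≤ DY) (hD2 : m - DX ≤ DY) (hn : DY * m ≤ DY * X0 - DX * Y0)
    (f11 : (Y0 + DY) + s1 * (X0 + DX) < 1 + s1 * c)
    (f20 : -Y0 + s2 * X0 < 1 + s2 * (m - c)) : False := by
  have a1 : -1 < s1 := by nlinarith
  have a2 : s1 < 1 := by nlinarith
  have a3 : -1 < s2 := by nlinarith
  have a4 : s2 < 1 := by nlinarith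
  have hR : 2 - s1 * (m - c) - s2 * c ≤ m := by
    by_cases hs1 : 0 ≤ s1
    · by_cases hs2 : 0 ≤ s2
      · nlinarith [mul_nonneg hs1 (by linarith : 0 ≤ m - c), mul_nonneg hs2 (by linarith : 0 ≤ c)]
      · push Not at hs2
        have e1 : (-s2) * (m - c) ≤ s1 * (m - c) :=
          mul_le_mul_of_nonneg_right (by linarith) (by linarith)
        by_cases h : m ≤ 2 * c
        · nlinarith [mul_le_mul_of_nonneg_right (by linarith : -s2 ≤ 1) (by linarith : 0 ≤ 2*c-m)]
        · push Not at h
          nlinarith [mul_nonneg (by linarith : 0 ≤ -s2) (by linarith : 0 ≤ m-2*c)]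
    · push Not at hs1
      have e1 : (-s1) * c ≤ s2 * c := mul_le_mul_of_nonneg_right (by linarith) (by linarith)
      by_cases h : 2 * c ≤ m
      · nlinarith [mul_le_mul_of_nonneg_right (by linarith : -s1 ≤ 1) (by linarith : 0 ≤ m-2*c)]
      · push Not at h
        nlinarith [mul_nonneg (by linarith : 0 ≤ -s1) (by linarith : 0 ≤ 2*c-m)]
  have b1 : m ≤ DY + s1 * DX := by
    rcases le_total 0 DX with h | h
    · nlinarith [mul_nonneg (by linarith : 0 ≤ 1 + s1) h]
    · nlinarith [mul_nonneg (by linarith : 0 ≤ 1 - s1) (by linarith : 0 ≤ -DX)]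
  have b2 : m ≤ DY - s2 * DX := by
    rcases le_total 0 DX with h | h
    · nlinarith [mul_nonneg (by linarith : 0 ≤ 1 - s2) h]
    · nlinarith [mul_nonneg (by linarith : 0 ≤ 1 + s2) (by linarith : 0 ≤ -DX)]
  have x0 : X0 < m := by
    by_contra h; push Not at h
    nlinarith [mul_nonneg hs (by linarith : 0 ≤ X0 - m)]
  have x1 : X0 + DX < m := by
    by_contra h; push Not at h
    nlinarith [mul_nonneg hs (by linarith : 0 ≤ X0 + DX - m)]
  have hDY : 0 < DY := by linarith
  have k0 : DX * Y0 < 0 := by nlinarith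
  have k1 : DX * (Y0 + DY) < 0 := by nlinarith
  rcases lt_trichotomy DX 0 with h | h | h
  · have y0 : 0 < Y0 := by nlinarith
    -- f1 at a1
    have q1 : (Y0 + DY) * DX ≤ DY * (X0 + DX - m) := by nlinarith
    by_cases hs1 : 0 ≤ s1
    · have q2 := mul_le_mul_of_nonneg_left q1 hs1
      have q3 : s1 * (Y0 + DY) * (-DX) ≤ 1 * (Y0 + DY) * (-DX) := by
        apply mul_le_mul_of_nonneg_right _ (by linarith)
        exact mul_le_mul_of_nonneg_right a2.le (by linarith)
      have q4 : (Y0 + DY) + s1 * (X0 + DX - m) < 1 := by nlinarith only [f11, mul_nonneg hs1 (by linarith : 0 ≤ m - c)]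
      have q5 : DY * ((Y0 + DY) + s1 * (X0 + DX - m)) < DY * 1 := mul_lt_mul_of_pos_left q4 hDY
      have q6 : (Y0 + DY) * m ≤ (Y0 + DY) * (DY + DX) :=
        mul_le_mul_of_nonneg_left (by linarith) (by linarith)
      have q7 : 2 * DY ≤ m * DY := mul_le_mul_of_nonneg_right hm hDY.le
      have q8 : 0 ≤ m * Y0 := mul_nonneg (by linarith) (by linarith)
      nlinarith only [q2, q3, q5, q6, q7, q8, hDY]
    · push Not at hs1
      have : 0 ≤ s1 * (X0 + DX - m) := by nlinarith
      have e : -s1 * (m - c) ≤ m - 1 := by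
        have : -s1 * (m-c) ≤ 1 * (m - c) := mul_le_mul_of_nonneg_right (by linarith) (by linarith)
        linarith
      nlinarith
  · subst h; linarith
  · have y0 : Y0 + DY < 0 := by nlinarith
    have q1 : Y0 * DX ≤ DY * (X0 - m) := by nlinarith
    by_cases hs2 : 0 ≤ s2
    · have q2 := mul_le_mul_of_nonneg_left q1 hs2
      have q3 : s2 * (-Y0) * DX ≤ 1 * (-Y0) * DX := by
        apply mul_le_mul_of_nonneg_right _ (by linarith)
        exact mul_le_mul_of_nonneg_right a4.le (by linarith)
      have q4 : (-Y0) + s2 * (X0 - m) < 1 := by nlinarith only [f20, mul_nonneg hs2 (by linarith : 0 ≤ c)]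
      have q5 : DY * ((-Y0) + s2 * (X0 - m)) < DY * 1 := mul_lt_mul_of_pos_left q4 hDY
      have q6 : (-Y0) * m ≤ (-Y0) * (DY - DX) :=
        mul_le_mul_of_nonneg_left (by linarith) (by linarith)
      have q7 : 2 * DY ≤ m * DY := mul_le_mul_of_nonneg_right hm hDY.le
      have q8 : 0 ≤ m * (-Y0 - DY) := mul_nonneg (by linarith) (by linarith)
      nlinarith only [q2, q3, q5, q6, q7, q8, hDY]
    · push Not at hs2
      have : 0 ≤ s2 * (X0 - m) := by nlinarith
      have e : -s2 * c ≤ m - 1 := by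
        have : -s2 * c ≤ 1 * c := mul_le_mul_of_nonneg_right (by linarith) (by linarith)
        linarith
      nlinarith

theorem edge_exists {ι : Type*} [Fintype ι] [Nonempty ι] (bx by' : ι → ℝ) (x y : ℝ)
    (hnot : ∃ p r : ℝ, ∀ i, p * bx i + r * by' i < p * x + r * y)
    (hnc : ∀ p r : ℝ, (∀ i j, p * bx i + r * by' i = p * bx j + r * by' j) → p = 0 ∧ r = 0) :
    ∃ (p r : ℝ) (i j : ι), ¬ (bx i = bx j ∧ by' i = by' j) ∧
      (∀ l, p * bx l + r * by' l ≤ p * bx i + r * by' i) ∧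
      p * bx i + r * by' i = p * bx j + r * by' j ∧
      p * bx i + r * by' i < p * x + r * y := by
  obtain ⟨p, r, hf⟩ := hnot
  obtain ⟨i, hi⟩ := Finite.exists_max (fun l => p * bx l + r * by' l)
  have hex : ∃ s : ℝ, ∃ l, 0 < s * ((x - bx i) * (by' l - by' i) - (y - by' i) * (bx l - bx i)) := by
    by_contra hcon
    push Not at hcon
    have hz : ∀ l, (x - bx i) * (by' l - by' i) - (y - by' i) * (bx l - bx i) = 0 := by
      intro l
      have h1 := hcon 1 l
      have h2 := hcon (-1) l
      linarith
    have := hnc (-(y - by' i)) (x - bx i) (by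
      intro a b
      have h1 := hz a
      have h2 := hz b
      linarith)
    have h3 := hf i
    have h4 : x = bx i := by linarith [this.2]
    have h5 : y = by' i := by linarith [this.1]
    rw [h4, h5] at h3
    exact lt_irrefl _ h3
  obtain ⟨s, l0, hl0⟩ := hex
  set G : ι → ℝ := fun l => s * ((x - bx i) * (by' l - by' i) - (y - by' i) * (bx l - bx i)) with hG
  have hJ : (Finset.univ.filter (fun l => 0 < G l)).Nonempty := ⟨l0, by simpa using hl0⟩
  obtain ⟨j, hj, hjmin⟩ := Finset.exists_min_image _
    (fun l => ((p * bx i + r * by' i) - (p * bx l + r * by' l)) / G l) hJ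
  simp only [Finset.mem_filter, Finset.mem_univ, true_and] at hj hjmin
  set t := ((p * bx i + r * by' i) - (p * bx j + r * by' j)) / G j with ht
  have ht0 : 0 ≤ t := div_nonneg (by linarith [hi j]) hj.le
  have htj : t * G j = (p * bx i + r * by' i) - (p * bx j + r * by' j) := by
    rw [ht]; field_simp
  refine ⟨p - t * s * (y - by' i), r + t * s * (x - bx i), i, j, ?_, ?_, ?_, ?_⟩
  · rintro ⟨h1, h2⟩
    have : G j = 0 := by simp only [hG]; rw [← h1, ← h2]; ring
    linarith
  · intro l
    have key : t * G l ≤ (p * bx i + r * by' i) - (p * bx l + r * by' l) := by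
      by_cases h : 0 < G l
      · exact (le_div_iff₀ h).mp (hjmin l h)
      · push Not at h
        have := hi l
        nlinarith
    simp only [hG] at key
    nlinarith
  · simp only [hG] at htj
    nlinarith
  · have := hf i
    nlinarith

/-- membership of a planar point in the hull of finitely many points, by support functions -/
def InS {ι : Type*} (ax ay : ι → ℝ) (x y : ℝ) : Prop :=
  ∀ p r : ℝ, ∃ i, p * x + r * y ≤ p * ax i + r * ay i

theorem InS_not {ι : Type*} {ax ay : ι → ℝ} {x y : ℝ} (h : ¬ InS ax ay x y) :
    ∃ p r : ℝ, ∀ i, p * ax i + r * ay i < p * x + r * y := by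
  unfold InS at h; push Not at h; exact h


theorem InS_mono {ι : Type*} {ax ay : ι → ℝ} {x y u v t : ℝ} (h0 : InS ax ay x y)
    (h1 : InS ax ay (x + u) (y + v)) (ht0 : 0 ≤ t) (ht1 : t ≤ 1) :
    InS ax ay (x + t * u) (y + t * v) := by
  intro p r
  rcases le_total 0 (p * u + r * v) with h | h
  · obtain ⟨i, hi⟩ := h1 p r
    refine ⟨i, le_trans ?_ hi⟩
    nlinarith
  · obtain ⟨i, hi⟩ := h0 p r
    refine ⟨i, le_trans ?_ hi⟩
    nlinarith

set_option maxHeartbeats 1000000 in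
theorem side {ι : Type*} [Fintype ι] [Nonempty ι] (ax ay bx by' : ι → ℤ)
    (hmax : ∀ p r : ℝ, ∀ i, (∀ l, p * bx l + r * by' l ≤ p * bx i + r * by' i) →
      ∀ l, p * ax l + r * ay l ≤ p * ax i + r * ay i)
    (hinj : ∀ i j, ax i = ax j → ay i = ay j → i = j)
    (x0 y0 ux uy s0 t0 vx vy wx wy : ℤ)
    (hA0 : InS (fun i => (ax i : ℝ)) (fun i => (ay i : ℝ)) x0 y0)
    (hA1 : InS (fun i => (ax i : ℝ)) (fun i => (ay i : ℝ)) (x0 + ux) (y0 + uy))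
    (hB0 : InS (fun i => (bx i : ℝ)) (fun i => (by' i : ℝ)) s0 t0)
    (hB1 : InS (fun i => (bx i : ℝ)) (fun i => (by' i : ℝ)) (s0 + vx) (t0 + vy))
    (hm : ux * vy - uy * vx ≠ 0)
    (hw : ¬ InS (fun i => (bx i : ℝ)) (fun i => (by' i : ℝ)) wx wy) :
    ∃ (i j : ι), 
      (ay j - ay i) * s0 - (ax j - ax i) * t0 < (ay j - ay i) * wx - (ax j - ax i) * wy ∧
      (ay j - ay i) * (s0 + vx) - (ax j - ax i) * (t0 + vy)
        < (ay j - ay i) * wx - (ax j - ax i) * wy ∧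
      (ay j - ay i) * x0 - (ax j - ax i) * y0 ≤ (ay j - ay i) * ax i - (ax j - ax i) * ay i ∧
      (ay j - ay i) * (x0 + ux) - (ax j - ax i) * (y0 + uy)
        ≤ (ay j - ay i) * ax i - (ax j - ax i) * ay i := by
  have hm' : (ux * vy - uy * vx : ℝ) ≠ 0 := by exact_mod_cast hm
  have hnc : ∀ p r : ℝ, (∀ i j, p * (bx i : ℝ) + r * (by' i : ℝ) = p * bx j + r * by' j) →
      p = 0 ∧ r = 0 := by
    intro p r hc
    have i0 : ι := Classical.arbitrary ι
    have hb : p * (vx : ℝ) + r * vy = 0 := by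
      obtain ⟨i1, h1⟩ := hB0 p r
      obtain ⟨i2, h2⟩ := hB0 (-p) (-r)
      obtain ⟨i3, h3⟩ := hB1 p r
      obtain ⟨i4, h4⟩ := hB1 (-p) (-r)
      have e1 := hc i1 i0; have e2 := hc i2 i0; have e3 := hc i3 i0; have e4 := hc i4 i0
      apply le_antisymm <;> linarith
    have hca : ∀ i j, p * (ax i : ℝ) + r * (ay i : ℝ) = p * ax j + r * ay j := by
      intro i j
      exact le_antisymm (hmax p r j (fun l => (hc l j).le) i) (hmax p r i (fun l => (hc l i).le) j)
    have ha : p * (ux : ℝ) + r * uy = 0 := by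
      obtain ⟨i1, h1⟩ := hA0 p r
      obtain ⟨i2, h2⟩ := hA0 (-p) (-r)
      obtain ⟨i3, h3⟩ := hA1 p r
      obtain ⟨i4, h4⟩ := hA1 (-p) (-r)
      have e1 := hca i1 i0; have e2 := hca i2 i0; have e3 := hca i3 i0; have e4 := hca i4 i0
      apply le_antisymm <;> linarith
    constructor
    · have : p * (ux * vy - uy * vx : ℝ) = 0 := by linear_combination vy * ha - uy * hb
      exact (mul_eq_zero.mp this).resolve_right hm'
    · have : r * (ux * vy - uy * vx : ℝ) = 0 := by linear_combination ux * hb - vx * ha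
      exact (mul_eq_zero.mp this).resolve_right hm'
  obtain ⟨p, r, i, j, hne, hl, hij, hlt⟩ := edge_exists _ _ _ _ (InS_not hw) hnc
  have hlj : ∀ l, p * (bx l : ℝ) + r * by' l ≤ p * bx j + r * by' j := fun l => (hl l).trans hij.le
  have mi := hmax p r i hl
  have mj := hmax p r j hlj
  have hD : p * ((ax j - ax i : ℤ) : ℝ) + r * ((ay j - ay i : ℤ) : ℝ) = 0 := by
    have := mi j; have := mj i
    push_cast
    apply le_antisymm <;> linarith
  have hD0 : 0 < ((ax j - ax i : ℤ) : ℝ) ^ 2 + ((ay j - ay i : ℤ) : ℝ) ^ 2 := by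
    by_contra hcon
    have h1 : ((ax j - ax i : ℤ) : ℝ) = 0 := by nlinarith [sq_nonneg ((ax j - ax i : ℤ) : ℝ), sq_nonneg ((ay j - ay i : ℤ) : ℝ)]
    have h2 : ((ay j - ay i : ℤ) : ℝ) = 0 := by nlinarith [sq_nonneg ((ax j - ax i : ℤ) : ℝ), sq_nonneg ((ay j - ay i : ℤ) : ℝ)]
    have h1' : ax j - ax i = 0 := by exact_mod_cast h1
    have h2' : ay j - ay i = 0 := by exact_mod_cast h2
    have := hinj i j (by omega) (by omega)
    subst this
    exact hne ⟨rfl, rfl⟩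
  obtain ⟨lam, hp, hr⟩ : ∃ lam : ℝ, p = lam * ((ay j - ay i : ℤ) : ℝ) ∧ r = - lam * ((ax j - ax i : ℤ) : ℝ) := by
    refine ⟨(p * ((ay j - ay i : ℤ) : ℝ) - r * ((ax j - ax i : ℤ) : ℝ)) / (((ax j - ax i : ℤ) : ℝ) ^ 2 + ((ay j - ay i : ℤ) : ℝ) ^ 2), ?_, ?_⟩
    · field_simp
      linear_combination ((ax j - ax i : ℤ) : ℝ) * hD
    · field_simp
      linear_combination ((ay j - ay i : ℤ) : ℝ) * hD
  obtain ⟨i1, h1⟩ := hB0 p r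
  obtain ⟨i2, h2⟩ := hB1 p r
  obtain ⟨i3, h3⟩ := hA0 p r
  obtain ⟨i4, h4⟩ := hA1 p r
  have h1 := h1.trans (hl i1)
  have h2 := h2.trans (hl i2)
  have h3 := h3.trans (mi i3)
  have h4 := h4.trans (mi i4)
  have hne0 : lam ≠ 0 := by
    rintro rfl
    simp at hp hr
    subst hp hr
    simp at hlt
  rw [hp, hr] at h1 h2 h3 h4 hlt
  have c1 := h1.trans_lt hlt
  have c2 := h2.trans_lt hlt
  rcases lt_or_gt_of_ne hne0 with hneg | hpos
  · refine ⟨j, i, ?_, ?_, ?_, ?_⟩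
    · have : ((ay i - ay j : ℤ) : ℝ) * s0 - ((ax i - ax j : ℤ) : ℝ) * t0 < ((ay i - ay j : ℤ) : ℝ) * wx - ((ax i - ax j : ℤ) : ℝ) * wy := by
        push_cast at c1 ⊢
        by_contra hcon; push Not at hcon
        nlinarith only [c1, mul_nonneg (by linarith : 0 ≤ -lam) (sub_nonneg.mpr hcon)]
      exact_mod_cast this
    · have : ((ay i - ay j : ℤ) : ℝ) * (s0 + vx) - ((ax i - ax j : ℤ) : ℝ) * (t0 + vy) < ((ay i - ay j : ℤ) : ℝ) * wx - ((ax i - ax j : ℤ) : ℝ) * wy := by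
        push_cast at c2 ⊢
        by_contra hcon; push Not at hcon
        nlinarith only [c2, mul_nonneg (by linarith : 0 ≤ -lam) (sub_nonneg.mpr hcon)]
      exact_mod_cast this
    · have : ((ay i - ay j : ℤ) : ℝ) * x0 - ((ax i - ax j : ℤ) : ℝ) * y0 ≤ ((ay i - ay j : ℤ) : ℝ) * ax j - ((ax i - ax j : ℤ) : ℝ) * ay j := by
        push_cast at h3 ⊢
        by_contra hcon; push Not at hcon
        nlinarith only [h3, mul_pos (by linarith : 0 < -lam) (sub_pos.mpr hcon)]
      exact_mod_cast this
    · have : ((ay i - ay j : ℤ) : ℝ) * (x0 + ux) - ((ax i - ax j : ℤ) : ℝ) * (y0 + uy) ≤ ((ay i - ay j : ℤ) : ℝ) * ax j - ((ax i - ax j : ℤ) : ℝ) * ay j := by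
        push_cast at h4 ⊢
        by_contra hcon; push Not at hcon
        nlinarith only [h4, mul_pos (by linarith : 0 < -lam) (sub_pos.mpr hcon)]
      exact_mod_cast this
  · refine ⟨i, j, ?_, ?_, ?_, ?_⟩
    · have : ((ay j - ay i : ℤ) : ℝ) * s0 - ((ax j - ax i : ℤ) : ℝ) * t0 < ((ay j - ay i : ℤ) : ℝ) * wx - ((ax j - ax i : ℤ) : ℝ) * wy := by
        push_cast at c1 ⊢
        by_contra hcon; push Not at hcon
        nlinarith only [c1, mul_nonneg hpos.le (sub_nonneg.mpr hcon)]
      exact_mod_cast this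
    · have : ((ay j - ay i : ℤ) : ℝ) * (s0 + vx) - ((ax j - ax i : ℤ) : ℝ) * (t0 + vy) < ((ay j - ay i : ℤ) : ℝ) * wx - ((ax j - ax i : ℤ) : ℝ) * wy := by
        push_cast at c2 ⊢
        by_contra hcon; push Not at hcon
        nlinarith only [c2, mul_nonneg hpos.le (sub_nonneg.mpr hcon)]
      exact_mod_cast this
    · have : ((ay j - ay i : ℤ) : ℝ) * x0 - ((ax j - ax i : ℤ) : ℝ) * y0 ≤ ((ay j - ay i : ℤ) : ℝ) * ax i - ((ax j - ax i : ℤ) : ℝ) * ay i := by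
        push_cast at h3 ⊢
        by_contra hcon; push Not at hcon
        nlinarith only [h3, mul_pos hpos (sub_pos.mpr hcon)]
      exact_mod_cast this
    · have : ((ay j - ay i : ℤ) : ℝ) * (x0 + ux) - ((ax j - ax i : ℤ) : ℝ) * (y0 + uy) ≤ ((ay j - ay i : ℤ) : ℝ) * ax i - ((ax j - ax i : ℤ) : ℝ) * ay i := by
        push_cast at h4 ⊢
        by_contra hcon; push Not at hcon
        nlinarith only [h4, mul_pos hpos (sub_pos.mpr hcon)]
      exact_mod_cast this

theorem getS (m c P Q : ℝ) (hc1 : 1 ≤ c) (hc2 : c ≤ m - 1) (h0 : 0 < P * c + Q)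
    (h1 : P * m < P * c + Q) : 0 < Q ∧ -(P / Q) * c < 1 ∧ (P / Q) * (m - c) < 1 ∧
      ∀ X Y : ℝ, P * X + Q * Y < P * c + Q → Y + (P / Q) * X < 1 + (P / Q) * c := by
  have hQ : 0 < Q := by
    rcases le_total 0 P with h | h
    · nlinarith
    · nlinarith
  refine ⟨hQ, ?_, ?_, ?_⟩
  · rw [← mul_lt_mul_iff_right₀ hQ]; field_simp; linarith
  · rw [← mul_lt_mul_iff_right₀ hQ]; field_simp; linarith
  · intro X Y h
    rw [← mul_lt_mul_iff_right₀ hQ]; field_simp; linarith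


/-- lattice vector adjacent to a primitive vector -/
theorem adj_exists (ux uy vx vy : ℤ) (hm : 2 ≤ ux * vy - uy * vx)
    (hu : IsCoprime ux uy) (hv : IsCoprime vx vy) :
    ∃ wx wy : ℤ, ux * wy - uy * wx = 1 ∧ 0 < wx * vy - wy * vx ∧
      wx * vy - wy * vx < ux * vy - uy * vx := by
  obtain ⟨a, b, hab⟩ := hu
  set m := ux * vy - uy * vx with hmdef
  set X := (-b) * vy - a * vx with hX
  refine ⟨-b - (X / m) * ux, a - (X / m) * uy, by linear_combination hab, ?_, ?_⟩
  · have e : (-b - (X / m) * ux) * vy - (a - (X / m) * uy) * vx = X % m := by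
      have := Int.emod_add_mul_ediv X m
      linear_combination -this - hX + (X/m) * hmdef
    rw [e]
    have h0 : 0 ≤ X % m := Int.emod_nonneg _ (by omega)
    rcases h0.lt_or_eq with h | h
    · exact h
    · exfalso
      set wx := -b - (X / m) * ux
      set wy := a - (X / m) * uy
      have e0 : wx * vy - wy * vx = 0 := by rw [e, ← h]
      have e1 : ux * wy - uy * wx = 1 := by linear_combination hab
      have k1 : m * wx = vx := by linear_combination wx * hmdef + vx * e1 + ux * e0
      have k2 : m * wy = vy := by linear_combination wy * hmdef + vy * e1 + uy * e0
      obtain ⟨c, d, hcd⟩ := hv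
      have : m * (c * wx + d * wy) = 1 := by rw [← k1, ← k2] at hcd; linear_combination hcd
      have := Int.eq_one_or_neg_one_of_mul_eq_one this
      omega
  · have e : (-b - (X / m) * ux) * vy - (a - (X / m) * uy) * vx = X % m := by
      have := Int.emod_add_mul_ediv X m
      linear_combination -this - hX + (X/m) * hmdef
    rw [e]
    exact Int.emod_lt_of_pos _ (by omega)

theorem nonprim {ι : Type*} (ax ay : ι → ℝ) (x0 y0 ux uy : ℤ) (hne : ¬ (ux = 0 ∧ uy = 0))
    (hA0 : InS ax ay x0 y0) (hA1 : InS ax ay (x0 + ux) (y0 + uy)) (hu : ¬ IsCoprime ux uy) :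
    ∃ wx wy g : ℤ, 2 ≤ g ∧ ux = g * wx ∧ uy = g * wy ∧
      InS ax ay ((x0 + wx : ℤ) : ℝ) ((y0 + wy : ℤ) : ℝ) := by
  have hg : Int.gcd ux uy ≠ 1 := fun h => hu (Int.isCoprime_iff_gcd_eq_one.mpr h)
  have hg0 : Int.gcd ux uy ≠ 0 := fun h => hne (Int.gcd_eq_zero_iff.mp h)
  obtain ⟨wx, hwx⟩ := Int.gcd_dvd_left ux uy
  obtain ⟨wy, hwy⟩ := Int.gcd_dvd_right ux uy
  have h2 : (2:ℤ) ≤ (Int.gcd ux uy : ℤ) := by omega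
  refine ⟨wx, wy, Int.gcd ux uy, h2, hwx, hwy, ?_⟩
  have h2' : (2:ℝ) ≤ (Int.gcd ux uy : ℤ) := by exact_mod_cast h2
  have e1 : (ux : ℝ) = ((Int.gcd ux uy : ℤ) : ℝ) * wx := by exact_mod_cast hwx
  have e2 : (uy : ℝ) = ((Int.gcd ux uy : ℤ) : ℝ) * wy := by exact_mod_cast hwy
  have := InS_mono (t := 1 / ((Int.gcd ux uy : ℤ) : ℝ)) hA0 hA1 (by positivity)
    (by rw [div_le_one (by linarith)]; linarith)
  convert this using 1
  · push_cast; rw [e1]; field_simp; push_cast; ring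
  · push_cast; rw [e2]; field_simp; push_cast; ring

set_option maxHeartbeats 2000000 in
theorem core22 {ι : Type*} [Fintype ι] [Nonempty ι] (ax ay bx by' : ι → ℤ)
    (hmax : ∀ p r : ℝ, ∀ i, (∀ l, p * bx l + r * by' l ≤ p * bx i + r * by' i) →
      ∀ l, p * ax l + r * ay l ≤ p * ax i + r * ay i)
    (hinj : ∀ i j, ax i = ax j → ay i = ay j → i = j)
    (x0 y0 ux uy s0 t0 vx vy m : ℤ)
    (hA0 : InS (fun i => (ax i : ℝ)) (fun i => (ay i : ℝ)) x0 y0)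
    (hA1 : InS (fun i => (ax i : ℝ)) (fun i => (ay i : ℝ)) (x0 + ux) (y0 + uy))
    (hB0 : InS (fun i => (bx i : ℝ)) (fun i => (by' i : ℝ)) s0 t0)
    (hB1 : InS (fun i => (bx i : ℝ)) (fun i => (by' i : ℝ)) (s0 + vx) (t0 + vy))
    (hmd : m = ux * vy - uy * vx) (hm : 2 ≤ m) :
    (∃ wx wy : ℤ, InS (fun i => (ax i : ℝ)) (fun i => (ay i : ℝ)) ((x0 + wx : ℤ) : ℝ) ((y0 + wy : ℤ) : ℝ)
      ∧ 0 < wx * vy - wy * vx ∧ wx * vy - wy * vx < m ∧ -m < ux * wy - uy * wx ∧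
        ux * wy - uy * wx < m) ∨
    (∃ wx wy : ℤ, InS (fun i => (bx i : ℝ)) (fun i => (by' i : ℝ)) ((s0 + wx : ℤ) : ℝ) ((t0 + wy : ℤ) : ℝ)
      ∧ -m < wx * vy - wy * vx ∧ wx * vy - wy * vx < m ∧ 0 < ux * wy - uy * wx ∧
        ux * wy - uy * wx < m) := by
  by_cases hu : IsCoprime ux uy
  swap
  · left
    obtain ⟨wx, wy, g, hg, h1, h2, h3⟩ := nonprim _ _ x0 y0 ux uy
      (by rintro ⟨rfl, rfl⟩; simp at hmd; omega) hA0 hA1 hu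
    have e : g * (wx * vy - wy * vx) = m := by rw [hmd, h1, h2]; ring
    refine ⟨wx, wy, h3, ?_, ?_, ?_, ?_⟩
    · nlinarith
    · nlinarith
    · rw [h1, h2]; ring_nf; omega
    · rw [h1, h2]; ring_nf; omega
  by_cases hv : IsCoprime vx vy
  swap
  · right
    obtain ⟨wx, wy, g, hg, h1, h2, h3⟩ := nonprim _ _ s0 t0 vx vy
      (by rintro ⟨rfl, rfl⟩; simp at hmd; omega) hB0 hB1 hv
    have e : g * (ux * wy - uy * wx) = m := by rw [hmd, h1, h2]; ring
    refine ⟨wx, wy, h3, ?_, ?_, ?_, ?_⟩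
    · rw [h1, h2]; ring_nf; omega
    · rw [h1, h2]; ring_nf; omega
    · nlinarith
    · nlinarith
  by_contra hcon
  rw [not_or] at hcon
  obtain ⟨hcA, hcB⟩ := hcon
  obtain ⟨wx, wy, hw1, hw2, hw3⟩ := adj_exists ux uy vx vy (by omega) hu hv
  -- neighbour of v
  obtain ⟨zx, zy, hz1, hz2, hz3⟩ := adj_exists (-vx) (-vy) ux uy (by linarith)
    (hv.neg_neg) hu
  have nA1 : ¬ InS (fun i => (ax i : ℝ)) (fun i => (ay i : ℝ)) ((x0 + wx : ℤ) : ℝ) ((y0 + wy : ℤ) : ℝ) :=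
    fun h => hcA ⟨wx, wy, h, by linarith, by linarith, by linarith, by linarith⟩
  have nA2 : ¬ InS (fun i => (ax i : ℝ)) (fun i => (ay i : ℝ)) ((x0 + (ux - wx) : ℤ) : ℝ) ((y0 + (uy - wy) : ℤ) : ℝ) :=
    fun h => hcA ⟨ux - wx, uy - wy, h, by linarith, by linarith, by linarith, by linarith⟩
  have nB1 : ¬ InS (fun i => (bx i : ℝ)) (fun i => (by' i : ℝ)) ((s0 + (vx + zx) : ℤ) : ℝ) ((t0 + (vy + zy) : ℤ) : ℝ) :=
    fun h => hcB ⟨vx + zx, vy + zy, h, by linarith, by linarith, by linarith, by linarith⟩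
  have nB2 : ¬ InS (fun i => (bx i : ℝ)) (fun i => (by' i : ℝ)) ((s0 - zx : ℤ) : ℝ) ((t0 - zy : ℤ) : ℝ) :=
    fun h => hcB ⟨-zx, -zy, by simpa [sub_eq_add_neg] using h, by linarith, by linarith, by linarith, by linarith⟩
  have hm0 : ux * vy - uy * vx ≠ 0 := by omega
  have sR := side ax ay bx by' hmax hinj x0 y0 ux uy s0 t0 vx vy _ _ hA0 hA1 hB0 hB1 hm0 nB1
  have sL := side ax ay bx by' hmax hinj x0 y0 ux uy s0 t0 vx vy _ _ hA0 hA1 hB0 hB1 hm0 nB2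
  obtain ⟨p1, r1, hf1⟩ := InS_not nA1
  obtain ⟨p2, r2, hf2⟩ := InS_not nA2
  -- coordinates
  have hmR : (m : ℝ) = ux * vy - uy * vx := by exact_mod_cast hmd
  have hmR2 : (2:ℝ) ≤ m := by exact_mod_cast hm
  have hmR0 : (m : ℝ) ≠ 0 := by linarith
  obtain ⟨c, hc⟩ : ∃ c : ℤ, c = wx * vy - wy * vx := ⟨_, rfl⟩
  have hcR : (c : ℝ) = wx * vy - wy * vx := by exact_mod_cast hc
  have hc1 : (1:ℝ) ≤ c := by exact_mod_cast (show (1:ℤ) ≤ c by omega)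
  have hc2 : (c:ℝ) ≤ m - 1 := by
    have : c ≤ m - 1 := by omega
    exact_mod_cast this
  have hw1R : (ux * wy - uy * wx : ℝ) = 1 := by exact_mod_cast hw1
  set XX : ι → ℝ := fun i => ((ax i : ℝ) - x0) * vy - ((ay i : ℝ) - y0) * vx with hXX
  set YY : ι → ℝ := fun i => ux * ((ay i : ℝ) - y0) - uy * ((ax i : ℝ) - x0) with hYY
  have conv : ∀ p r x y : ℝ, m * (p * x + r * y) = (p * ux + r * uy) * (x * vy - y * vx)
      + (p * vx + r * vy) * (ux * y - uy * x) := by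
    intro p r x y; rw [hmR]; ring
  have hmpos : (0:ℝ) < m := by linarith
  -- upper functional
  have S1 : ∃ s : ℝ, -s * c < 1 ∧ s * (m - c) < 1 ∧ ∀ i, YY i + s * XX i < 1 + s * c := by
    have hf : ∀ x y : ℝ, p1 * x + r1 * y < p1 * wx + r1 * wy →
       (p1 * ux + r1 * uy) * (x * vy - y * vx) + (p1 * vx + r1 * vy) * (ux * y - uy * x) <
       (p1 * ux + r1 * uy) * c + (p1 * vx + r1 * vy) := by
      intro x y h
      have h1 := mul_lt_mul_of_pos_left h hmpos
      rw [conv, conv, hw1R, ← hcR] at h1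
      linarith
    obtain ⟨i0, g0⟩ := hA0 p1 r1
    obtain ⟨i1, g1⟩ := hA1 p1 r1
    have k0 := hf 0 0 (by have := hf1 i0; push_cast at this; linarith)
    have k1 := hf ux uy (by have := hf1 i1; push_cast at this; linarith)
    obtain ⟨hQ, q1, q2, q3⟩ := getS m c (p1 * ux + r1 * uy) (p1 * vx + r1 * vy) hc1 hc2
      (by linarith) (by rw [hmR]; linarith)
    refine ⟨_, q1, q2, fun i => q3 _ _ ?_⟩
    exact hf _ _ (by have := hf1 i; push_cast at this; linarith)
  have S2 : ∃ s : ℝ, -s * (m - c) < 1 ∧ s * c < 1 ∧ ∀ i, -YY i + s * XX i < 1 + s * (m - c) := by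
    have hf : ∀ x y : ℝ, p2 * x + r2 * y < p2 * (ux - wx) + r2 * (uy - wy) →
       -(p2 * ux + r2 * uy) * (m - (x * vy - y * vx)) + -(p2 * vx + r2 * vy) * (-(ux * y - uy * x)) <
       -(p2 * ux + r2 * uy) * c + -(p2 * vx + r2 * vy) := by
      intro x y h
      have h1 := mul_lt_mul_of_pos_left h hmpos
      rw [conv, conv] at h1
      have e1 : ((ux:ℝ) - wx) * vy - (uy - wy) * vx = m - c := by rw [hmR, hcR]; ring
      have e2 : (ux:ℝ) * (uy - wy) - uy * (ux - wx) = -1 := by linear_combination -hw1R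
      rw [e1, e2] at h1
      linarith
    obtain ⟨i0, g0⟩ := hA0 p2 r2
    obtain ⟨i1, g1⟩ := hA1 p2 r2
    have k0 := hf 0 0 (by have := hf2 i0; push_cast at this; linarith)
    have k1 := hf ux uy (by have := hf2 i1; push_cast at this; linarith)
    rw [show (ux:ℝ) * vy - uy * vx = m from hmR.symm] at k1
    obtain ⟨hQ, q1, q2, q3⟩ := getS m c (-(p2 * ux + r2 * uy)) (-(p2 * vx + r2 * vy)) hc1 hc2
      (by linarith) (by linarith)
    refine ⟨-(-(p2 * ux + r2 * uy) / -(p2 * vx + r2 * vy)), by linarith, by linarith, fun i => ?_⟩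
    have := q3 _ _ (hf ((ax i : ℝ) - x0) ((ay i : ℝ) - y0) (by have := hf2 i; push_cast at this; linarith))
    simp only [hXX, hYY]
    linarith
  obtain ⟨s1, u1, u2, u3⟩ := S1
  obtain ⟨s2, w1, w2, w3⟩ := S2
  have hzR : (zx * vy - zy * vx : ℝ) = 1 := by
    have : zx * vy - zy * vx = 1 := by linarith
    exact_mod_cast this
  obtain ⟨e, he⟩ : ∃ e : ℤ, e = zx * uy - zy * ux := ⟨_, rfl⟩
  have heR : (e : ℝ) = zx * uy - zy * ux := by exact_mod_cast he
  have he1 : (1:ℝ) ≤ e := by exact_mod_cast (show (1:ℤ) ≤ e by omega)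
  have he2 : (e:ℝ) ≤ m - 1 := by
    have : e ≤ m - 1 := by linarith
    exact_mod_cast this
  rcases le_total 0 (s1 + s2) with hs | hs
  · obtain ⟨i, j, n1, n2, n3, n4⟩ := sR
    have n1' : ((ay j - ay i) * s0 - (ax j - ax i) * t0 : ℝ) + 1 ≤ (ay j - ay i) * (s0 + (vx + zx)) - (ax j - ax i) * (t0 + (vy + zy)) := by exact_mod_cast n1
    have n2' : ((ay j - ay i) * (s0 + vx) - (ax j - ax i) * (t0 + vy) : ℝ) + 1 ≤ (ay j - ay i) * (s0 + (vx + zx)) - (ax j - ax i) * (t0 + (vy + zy)) := by exact_mod_cast n2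
    have n4' : ((ay j - ay i) * (x0 + ux) - (ax j - ax i) * (y0 + uy) : ℝ)
        ≤ (ay j - ay i) * ax i - (ax j - ax i) * ay i := by exact_mod_cast n4
    obtain ⟨DX, hDX⟩ : ∃ DX : ℝ, DX = XX j - XX i := ⟨_, rfl⟩
    obtain ⟨DY, hDY⟩ : ∃ DY : ℝ, DY = YY j - YY i := ⟨_, rfl⟩
    have cx : ∀ x y : ℝ, m * ((ay j - ay i) * x - (ax j - ax i) * y) = DY * (x * vy - y * vx) - DX * (ux * y - uy * x) := by
      intro x y; rw [hDX, hDY, hmR]; simp only [hXX, hYY]; ring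
    have t1 : DX * (m - e) + m ≤ DY := by
      have h := cx (vx + zx) (vy + zy)
      have h' := mul_le_mul_of_nonneg_left (show (1:ℝ) ≤ (ay j - ay i) * (vx + zx) - (ax j - ax i) * (vy + zy) by linarith) hmpos.le
      rw [h, show ((vx:ℝ) + zx) * vy - (vy + zy) * vx = 1 by linarith, show (ux:ℝ) * (vy + zy) - uy * (vx + zx) = m - e by rw [hmR, heR]; ring] at h'
      linarith
    have t2 : -DX * e + m ≤ DY := by
      have h := cx (zx) (zy)
      have h' := mul_le_mul_of_nonneg_left (show (1:ℝ) ≤ (ay j - ay i) * (zx) - (ax j - ax i) * (zy) by linarith) hmpos.le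
      rw [h, show ((zx:ℝ)) * vy - (zy) * vx = 1 by linarith, show (ux:ℝ) * (zy) - uy * (zx) = - e by rw [heR]; ring] at h'
      linarith
    have t3 : DY * m ≤ DY * XX i - DX * YY i := by
      have h' := mul_le_mul_of_nonneg_left (show ((ay j - ay i) * ux - (ax j - ax i) * uy : ℝ) ≤ (ay j - ay i) * (ax i - x0) - (ax j - ax i) * (ay i - y0) by linarith) hmpos.le
      rw [cx, cx, ← hmR] at h'
      simp only [hXX, hYY]; linarith
    refine NL m c s1 s2 DX DY (XX i) (YY i) hmR2 hc1 hc2 hs u1 u2 w1 w2 ?_ ?_ t3 ?_ (w3 i)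
    · rcases le_total 0 DX with h | h <;> nlinarith
    · rcases le_total 0 DX with h | h <;> nlinarith
    · have := u3 j
      rw [show XX j = XX i + DX by rw [hDX]; ring, show YY j = YY i + DY by rw [hDY]; ring] at this
      exact this
  · obtain ⟨i, j, n1, n2, n3, n4⟩ := sL
    have n1' : ((ay j - ay i) * s0 - (ax j - ax i) * t0 : ℝ) + 1 ≤ (ay j - ay i) * (s0 - zx) - (ax j - ax i) * (t0 - zy) := by exact_mod_cast n1
    have n2' : ((ay j - ay i) * (s0 + vx) - (ax j - ax i) * (t0 + vy) : ℝ) + 1 ≤ (ay j - ay i) * (s0 - zx) - (ax j - ax i) * (t0 - zy) := by exact_mod_cast n2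
    have n3' : ((ay j - ay i) * x0 - (ax j - ax i) * y0 : ℝ)
        ≤ (ay j - ay i) * ax i - (ax j - ax i) * ay i := by exact_mod_cast n3
    obtain ⟨DX, hDX⟩ : ∃ DX : ℝ, DX = XX j - XX i := ⟨_, rfl⟩
    obtain ⟨DY, hDY⟩ : ∃ DY : ℝ, DY = YY j - YY i := ⟨_, rfl⟩
    have cx : ∀ x y : ℝ, m * ((ay j - ay i) * x - (ax j - ax i) * y) = DY * (x * vy - y * vx) - DX * (ux * y - uy * x) := by
      intro x y; rw [hDX, hDY, hmR]; simp only [hXX, hYY]; ring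
    have t1 : -DX * (m - e) + DY ≤ -m := by
      have h := cx (vx + zx) (vy + zy)
      have h' := mul_le_mul_of_nonneg_left (show (1:ℝ) ≤ -((ay j - ay i) * (vx + zx) - (ax j - ax i) * (vy + zy)) by linarith) hmpos.le
      rw [mul_neg, h, show ((vx:ℝ) + zx) * vy - (vy + zy) * vx = 1 by linarith, show (ux:ℝ) * (vy + zy) - uy * (vx + zx) = m - e by rw [hmR, heR]; ring] at h'
      linarith
    have t2 : DX * e + DY ≤ -m := by
      have h := cx (zx) (zy)
      have h' := mul_le_mul_of_nonneg_left (show (1:ℝ) ≤ -((ay j - ay i) * (zx) - (ax j - ax i) * (zy)) by linarith) hmpos.le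
      rw [mul_neg, h, show ((zx:ℝ)) * vy - (zy) * vx = 1 by linarith, show (ux:ℝ) * (zy) - uy * (zx) = - e by rw [heR]; ring] at h'
      linarith
    have t3 : 0 ≤ DY * XX i - DX * YY i := by
      have h' := mul_le_mul_of_nonneg_left (show (0 : ℝ) ≤ (ay j - ay i) * (ax i - x0) - (ax j - ax i) * (ay i - y0) by linarith) hmpos.le
      rw [cx] at h'
      simp only [hXX, hYY]; linarith
    refine NL m c (-s2) (-s1) (-DX) (-DY) (m - XX i) (-YY i) hmR2 hc1 hc2 (by linarith) (by linarith) (by linarith) (by linarith) (by linarith) ?_ ?_ (by linarith) ?_ (by have := u3 i; linarith)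
    · rcases le_total 0 DX with h | h <;> nlinarith
    · rcases le_total 0 DX with h | h <;> nlinarith
    · have := w3 j
      rw [show XX j = XX i + DX by rw [hDX]; ring, show YY j = YY i + DY by rw [hDY]; ring] at this
      linarith


def hom4 (q : Fin 3 → ℤ) : Fin 4 → ℝ := ![(q 0 : ℝ), q 1, q 2, 1]
def HM (v : Fin 4 → Fin 3 → ℤ) : Matrix (Fin 4) (Fin 4) ℝ := Matrix.of fun i => hom4 (v i)
def D3 (v : Fin 4 → Fin 3 → ℤ) : ℤ := (Matrix.of ![v 1 - v 0, v 2 - v 0, v 3 - v 0]).det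

theorem HM_det (v : Fin 4 → Fin 3 → ℤ) : (HM v).det = -(D3 v : ℝ) := by
  unfold HM D3 hom4
  rw [Matrix.det_fin_three]
  simp [Matrix.det_succ_row_zero, Fin.sum_univ_succ, Fin.succAbove]
  ring

theorem det_repl (V : Matrix (Fin 4) (Fin 4) ℝ) (q c : Fin 4 → ℝ) (hq : q = ∑ i, c i • V i)
    (i : Fin 4) : (V.updateRow i q).det = c i * V.det := by
  rw [hq, Matrix.det_updateRow_sum]; simp

theorem HM_update (v : Fin 4 → Fin 3 → ℤ) (i : Fin 4) (q : Fin 3 → ℤ) :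
    HM (Function.update v i q) = (HM v).updateRow i (hom4 q) := by
  ext a b
  by_cases h : a = i
  · subst h; simp [HM, Matrix.updateRow_apply]
  · simp [HM, Matrix.updateRow_apply, h]

theorem conecov (V : Matrix (Fin 4) (Fin 4) ℝ) (q c x l : Fin 4 → ℝ) (mu : ℝ)
    (hq : q = ∑ i, c i • V i) (hc : ∃ i, 0 < c i) (hl : ∀ i, 0 ≤ l i) (hmu : 0 ≤ mu)
    (hx : x = mu • q + ∑ i, l i • V i) :
    ∃ i, 0 < c i ∧ ∃ l' : Fin 4 → ℝ, (∀ i, 0 ≤ l' i) ∧ x = ∑ j, l' j • (V.updateRow i q) j := by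
  obtain ⟨i0, hi0⟩ := hc
  obtain ⟨i, hi, hmin⟩ := Finset.exists_min_image (Finset.univ.filter fun i => 0 < c i)
    (fun i => l i / c i) ⟨i0, by simpa using hi0⟩
  simp only [Finset.mem_filter, Finset.mem_univ, true_and] at hi hmin
  have ht : 0 ≤ l i / c i := div_nonneg (hl i) hi.le
  refine ⟨i, hi, fun j => if j = i then mu + l i / c i else l j - l i / c i * c j, ?_, ?_⟩
  · intro j
    dsimp only
    split_ifs with h
    · linarith
    · by_cases hj : 0 < c j
      · have := hmin j hj
        rw [le_div_iff₀ hj] at this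
        linarith
      · have := mul_nonneg ht (by linarith : 0 ≤ - c j)
        have := hl j
        linarith
  · have e : ∀ j, (if j = i then mu + l i / c i else l j - l i / c i * c j) • (V.updateRow i q) j
        = (l j - l i / c i * c j) • V j + if j = i then (mu + l i / c i) • q else 0 := by
      intro j
      split_ifs with h
      · subst h
        have : l j - l j / c j * c j = 0 := by field_simp; ring
        rw [this]
        simp
      · simp [Matrix.updateRow_ne h]
    simp only [e, Finset.sum_add_distrib, Finset.sum_ite_eq', Finset.mem_univ, if_true, sub_smul,
      Finset.sum_sub_distrib, mul_smul, ← Finset.smul_sum, ← hq]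
    rw [hx, add_smul]; abel

theorem coeff_exists (V : Matrix (Fin 4) (Fin 4) ℝ) (hV : V.det ≠ 0) (q : Fin 4 → ℝ) :
    ∃ c : Fin 4 → ℝ, q = ∑ i, c i • V i := by
  refine ⟨Matrix.vecMul q V⁻¹, ?_⟩
  have : Matrix.vecMul (Matrix.vecMul q V⁻¹) V = q := by
    rw [Matrix.vecMul_vecMul, Matrix.nonsing_inv_mul _ (isUnit_iff_ne_zero.mpr hV), Matrix.vecMul_one]
  rw [← Matrix.vecMul_eq_sum]; exact this.symm

theorem sum_one {V : Fin 4 → Fin 3 → ℤ} {q : Fin 3 → ℤ} {c : Fin 4 → ℝ}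
    (hq : hom4 q = ∑ i, c i • HM V i) : ∑ i, c i = 1 := by
  have := congrFun hq 3
  simp [hom4, HM] at this
  exact this.symm

theorem pos_exists {V : Fin 4 → Fin 3 → ℤ} {q : Fin 3 → ℤ} {c : Fin 4 → ℝ}
    (hq : hom4 q = ∑ i, c i • HM V i) : ∃ i, 0 < c i := by
  by_contra h
  push Not at h
  have := sum_one hq
  have := Finset.sum_nonpos (fun i (_ : i ∈ Finset.univ) => h i)
  linarith

def InT (v : Fin 4 → Fin 3 → ℤ) (x : Fin 4 → ℝ) : Prop :=
  ∃ l : Fin 4 → ℝ, (∀ i, 0 ≤ l i) ∧ x = ∑ j, l j • HM v j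

theorem init_tet {κ : Type*} (pt : κ → Fin 3 → ℤ) (v0 : Fin 4 → Fin 3 → ℤ)
    (h0 : ∀ i, v0 i ∈ Set.range pt) (hD : D3 v0 ≠ 0) (w : κ → ℝ) (hw : ∀ k, 0 ≤ w k) (s : Finset κ) :
    ∃ v : Fin 4 → Fin 3 → ℤ, (∀ i, v i ∈ Set.range pt) ∧ D3 v ≠ 0 ∧
      InT v (∑ k ∈ s, w k • hom4 (pt k)) := by
  classical
  induction s using Finset.induction_on with
  | empty => exact ⟨v0, h0, hD, 0, by simp, by simp⟩
  | insert a s ha ih =>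
    obtain ⟨v, hv, hDv, l, hl, hx⟩ := ih
    have hdet : (HM v).det ≠ 0 := by rw [HM_det]; simpa using hDv
    obtain ⟨c, hc⟩ := coeff_exists (HM v) hdet (hom4 (pt a))
    obtain ⟨i, hi, l', hl', hx'⟩ := conecov (HM v) _ c (∑ k ∈ insert a s, w k • hom4 (pt k)) l (w a) hc
      (pos_exists hc) hl (hw a) (by rw [Finset.sum_insert ha, hx])
    refine ⟨Function.update v i (pt a), ?_, ?_, l', hl', by rw [HM_update]; exact hx'⟩
    · intro j
      by_cases h : j = i
      · subst h; simp
      · simpa [h] using hv j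
    · have := det_repl (HM v) _ c hc i
      rw [← HM_update, HM_det, HM_det] at this
      intro h
      rw [h] at this
      have h2 : (c i * -(D3 v : ℝ)) ≠ 0 := mul_ne_zero hi.ne' (by simpa using hDv)
      apply h2
      rw [← this]; simp

theorem descent (good : (Fin 3 → ℤ) → Prop)
    (step : ∀ v : Fin 4 → Fin 3 → ℤ, (∀ i, good (v i)) → 2 ≤ |D3 v| →
      ∃ q, good q ∧ ∃ c : Fin 4 → ℝ, hom4 q = ∑ i, c i • HM v i ∧ ∀ i, c i < 1)
    (x : Fin 4 → ℝ) (n : ℕ) : ∀ v : Fin 4 → Fin 3 → ℤ, (∀ i, good (v i)) → D3 v ≠ 0 →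
      (D3 v).natAbs = n → InT v x →
      ∃ v' : Fin 4 → Fin 3 → ℤ, (∀ i, good (v' i)) ∧ (D3 v' = 1 ∨ D3 v' = -1) ∧ InT v' x := by
  induction n using Nat.strong_induction_on with
  | _ n ih =>
    intro v hv hD hn hx
    by_cases h2 : 2 ≤ |D3 v|
    · obtain ⟨q, hq, c, hc, hlt⟩ := step v hv h2
      obtain ⟨l, hl, hx⟩ := hx
      obtain ⟨i, hi, l', hl', hx'⟩ := conecov (HM v) _ c x l 0 hc
        (pos_exists hc) hl le_rfl (by rw [hx]; simp)
      have hdet := det_repl (HM v) _ c hc i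
      rw [← HM_update, HM_det, HM_det] at hdet
      have hdet' : (D3 (Function.update v i q) : ℝ) = c i * D3 v := by linarith
      have hne : D3 (Function.update v i q) ≠ 0 := by
        intro h
        rw [h] at hdet'
        have h2 : (c i * (D3 v : ℝ)) ≠ 0 := mul_ne_zero hi.ne' (by simpa using hD)
        apply h2
        rw [← hdet']; simp
      refine ih _ ?_ (Function.update v i q) ?_ hne rfl ⟨l', hl', by rw [HM_update]; exact hx'⟩
      · rw [← hn]
        have : |(D3 (Function.update v i q) : ℝ)| < |(D3 v : ℝ)| := by
          rw [hdet', abs_mul, abs_of_pos hi]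
          have : 0 < |(D3 v : ℝ)| := abs_pos.mpr (by simpa using hD)
          nlinarith [hlt i]
        have h3 : |D3 (Function.update v i q)| < |D3 v| := by exact_mod_cast this
        rw [Int.abs_eq_natAbs, Int.abs_eq_natAbs] at h3
        exact_mod_cast h3
      · intro j
        by_cases h : j = i
        · subst h; simpa using hq
        · simpa [h] using hv j
    · refine ⟨v, hv, ?_, hx⟩
      have : 0 < |D3 v| := abs_pos.mpr hD
      have h1 : |D3 v| = 1 := by omega
      exact (abs_eq zero_le_one).mp h1

theorem InT_hull (v : Fin 4 → Fin 3 → ℤ) (x y z : ℝ) (h : InT v ![x, y, z, 1]) :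
    (![x, y, z] : Fin 3 → ℝ) ∈ convexHull ℝ {(fun i => (v 0 i : ℝ)), (fun i => (v 1 i : ℝ)), (fun i => (v 2 i : ℝ)), (fun i => (v 3 i : ℝ))} := by
  obtain ⟨l, hl, hx⟩ := h
  have e0 := congrFun hx 0
  have e1 := congrFun hx 1
  have e2 := congrFun hx 2
  have e3 := congrFun hx 3
  simp [HM, hom4] at e0 e1 e2 e3
  have key : (![x, y, z] : Fin 3 → ℝ) = ∑ j, l j • (fun i => (v j i : ℝ)) := by
    ext i
    fin_cases i <;> simp [e0, e1, e2]
  rw [key]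
  refine (convex_convexHull ℝ _).sum_mem (fun i _ => hl i) e3.symm ?_
  intro i _
  apply subset_convexHull
  fin_cases i <;> simp

theorem exists_T0 {κ : Type*} (pt : κ → Fin 3 → ℤ)
    (h : ∀ p r s t : ℝ, (∀ k, p * pt k 0 + r * pt k 1 + s * pt k 2 + t = 0) → p = 0 ∧ r = 0 ∧ s = 0 ∧ t = 0) :
    ∃ v0 : Fin 4 → Fin 3 → ℤ, (∀ i, v0 i ∈ Set.range pt) ∧ D3 v0 ≠ 0 := by
  have hspan : Submodule.span ℝ (Set.range fun k => hom4 (pt k)) = ⊤ := by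
    by_contra hne
    obtain ⟨f, hf, hk⟩ := Submodule.exists_le_ker_of_lt_top _ (lt_top_iff_ne_top.mpr hne)
    apply hf
    have hfx : ∀ x : Fin 4 → ℝ, f x = f (Pi.single 0 1) * x 0 + f (Pi.single 1 1) * x 1 + f (Pi.single 2 1) * x 2 + f (Pi.single 3 1) * x 3 := by
      intro x
      have := LinearMap.pi_apply_eq_sum_univ f x
      rw [this]
      simp only [Fin.sum_univ_four, smul_eq_mul]
      have e : ∀ i : Fin 4, (fun j => if i = j then (1:ℝ) else 0) = Pi.single i 1 := by
        intro i; ext j; simp [Pi.single_apply, eq_comm]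
      simp only [e]; ring
    have h0 := h (f (Pi.single 0 1)) (f (Pi.single 1 1)) (f (Pi.single 2 1)) (f (Pi.single 3 1)) (by
      intro k
      have : hom4 (pt k) ∈ LinearMap.ker f := hk (Submodule.subset_span ⟨k, rfl⟩)
      rw [LinearMap.mem_ker, hfx] at this
      simpa [hom4] using this)
    obtain ⟨a, b, c, d⟩ := h0
    refine LinearMap.ext fun x => ?_
    rw [hfx, a, b, c, d]; simp only [zero_mul, add_zero, LinearMap.zero_apply]
  obtain ⟨b, hb, hbs, hli⟩ := exists_linearIndependent ℝ (Set.range fun k => hom4 (pt k))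
  rw [hspan] at hbs
  let B : Module.Basis b ℝ (Fin 4 → ℝ) := Module.Basis.mk hli (by rw [Subtype.range_coe]; exact hbs.ge)
  haveI : Fintype b := FiniteDimensional.fintypeBasisIndex B
  have hcard : Fintype.card b = 4 := by
    rw [← Module.finrank_eq_card_basis B]; simp
  let e : Fin 4 ≃ b := (Fintype.equivFinOfCardEq hcard).symm
  have hk : ∀ i, ∃ k, hom4 (pt k) = (e i : Fin 4 → ℝ) := fun i => hb (e i).2
  choose k hk using hk
  refine ⟨fun i => pt (k i), fun i => ⟨_, rfl⟩, ?_⟩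
  have hli2 : LinearIndependent ℝ (fun i => (e i : Fin 4 → ℝ)) := hli.comp e e.injective
  have hu : IsUnit (HM fun i => pt (k i)) := by
    rw [← Matrix.linearIndependent_rows_iff_isUnit]
    have e2 : (HM fun i => pt (k i)).row = (fun i => (e i : Fin 4 → ℝ)) := by
      ext i j
      simp [HM, Matrix.row, hk]
    rw [e2]; exact hli2
  rw [Matrix.isUnit_iff_isUnit_det, HM_det] at hu
  intro h0
  rw [h0] at hu
  simp at hu


theorem frac_pt (zx zy ux uy wx wy m : ℤ) (hmd : m = ux * wy - uy * wx) (hm : m ≠ 0)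
    (hX : ¬ (m ∣ zx * wy - zy * wx ∧ m ∣ ux * zy - uy * zx)) :
    ∃ (zx zy : ℤ) (al be : ℝ), 0 ≤ al ∧ al < 1 ∧ 0 ≤ be ∧ be < 1 ∧ 0 < al + be ∧
      (zx : ℝ) = al * ux + be * wx ∧ (zy : ℝ) = al * uy + be * wy := by
  have hmR : (m : ℝ) = ux * wy - uy * wx := by exact_mod_cast hmd
  have hmR0 : (m : ℝ) ≠ 0 := by exact_mod_cast hm
  obtain ⟨X, hXd⟩ : ∃ X : ℤ, X = zx * wy - zy * wx := ⟨_, rfl⟩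
  obtain ⟨Y, hYd⟩ : ∃ Y : ℤ, Y = ux * zy - uy * zx := ⟨_, rfl⟩
  have hXR : (X : ℝ) = zx * wy - zy * wx := by exact_mod_cast hXd
  have hYR : (Y : ℝ) = ux * zy - uy * zx := by exact_mod_cast hYd
  have dv : ∀ X : ℤ, Int.fract ((X : ℝ) / m) = 0 → m ∣ X := by
    intro X h
    rw [Int.fract, sub_eq_zero, div_eq_iff hmR0] at h
    refine ⟨⌊(X:ℝ)/m⌋, ?_⟩
    have : (X:ℝ) = ((m * ⌊(X:ℝ)/m⌋ : ℤ) : ℝ) := by push_cast; linarith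
    exact_mod_cast this
  refine ⟨zx - ⌊(X:ℝ)/m⌋ * ux - ⌊(Y:ℝ)/m⌋ * wx, zy - ⌊(X:ℝ)/m⌋ * uy - ⌊(Y:ℝ)/m⌋ * wy,
    Int.fract ((X:ℝ)/m), Int.fract ((Y:ℝ)/m), Int.fract_nonneg _, Int.fract_lt_one _,
    Int.fract_nonneg _, Int.fract_lt_one _, ?_, ?_, ?_⟩
  · by_contra h
    have h1 := Int.fract_nonneg ((X:ℝ)/m)
    have h2 := Int.fract_nonneg ((Y:ℝ)/m)
    apply hX
    rw [← hXd, ← hYd]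
    exact ⟨dv _ (by linarith), dv _ (by linarith)⟩
  · have : (zx : ℝ) = X / m * ux + Y / m * wx := by
      field_simp; rw [hXR, hYR, hmR]; ring
    simp only [Int.fract]; push_cast
    linear_combination this
  · have : (zy : ℝ) = X / m * uy + Y / m * wy := by
      field_simp; rw [hXR, hYR, hmR]; ring
    simp only [Int.fract]; push_cast
    linear_combination this

theorem tri_pt (ux uy wx wy m : ℤ) (hmd : m = ux * wy - uy * wx) (hm : 2 ≤ |m|) :
    ∃ (zx zy : ℤ) (al be : ℝ), 0 ≤ al ∧ al < 1 ∧ 0 ≤ be ∧ be < 1 ∧ 0 < al + be ∧ al + be ≤ 1 ∧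
      (zx : ℝ) = al * ux + be * wx ∧ (zy : ℝ) = al * uy + be * wy := by
  have hm0 : m ≠ 0 := by rintro rfl; simp at hm
  have : ∃ (zx zy : ℤ) (al be : ℝ), 0 ≤ al ∧ al < 1 ∧ 0 ≤ be ∧ be < 1 ∧ 0 < al + be ∧
      (zx : ℝ) = al * ux + be * wx ∧ (zy : ℝ) = al * uy + be * wy := by
    by_cases h1 : (m ∣ 1 * wy - 0 * wx ∧ m ∣ ux * 0 - uy * 1)
    · by_cases h2 : (m ∣ 0 * wy - 1 * wx ∧ m ∣ ux * 1 - uy * 0)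
      · exfalso
        simp at h1 h2
        obtain ⟨⟨a, rfl⟩, ⟨b, rfl⟩⟩ := h1
        obtain ⟨⟨c, rfl⟩, ⟨d, rfl⟩⟩ := h2
        have : m * (m * (d * a - b * c) - 1) = 0 := by linear_combination -hmd
        have h3 : m * (d * a - b * c) = 1 := by
          have := (mul_eq_zero.mp this).resolve_left hm0
          linarith
        rcases Int.eq_one_or_neg_one_of_mul_eq_one h3 with h | h <;> rw [h] at hm <;> simp at hm
      · exact frac_pt 0 1 ux uy wx wy m hmd hm0 h2
    · exact frac_pt 1 0 ux uy wx wy m hmd hm0 h1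
  obtain ⟨zx, zy, al, be, h1, h2, h3, h4, h5, h6, h7⟩ := this
  by_cases h : al + be ≤ 1
  · exact ⟨zx, zy, al, be, h1, h2, h3, h4, h5, h, h6, h7⟩
  · refine ⟨ux + wx - zx, uy + wy - zy, 1 - al, 1 - be, by linarith, by linarith, by linarith,
      by linarith, by linarith, by linarith, ?_, ?_⟩
    · push_cast; rw [h6]; ring
    · push_cast; rw [h7]; ring

theorem InS_tri {ι : Type*} {ax ay : ι → ℝ} {x y ux uy wx wy al be : ℝ} (h0 : InS ax ay x y)
    (h1 : InS ax ay (x + ux) (y + uy)) (h2 : InS ax ay (x + wx) (y + wy)) (ha : 0 ≤ al) (hb : 0 ≤ be)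
    (hp : 0 < al + be) (hab : al + be ≤ 1) :
    InS ax ay (x + (al * ux + be * wx)) (y + (al * uy + be * wy)) := by
  have k := InS_mono (t := be / (al + be)) (u := wx - ux) (v := wy - uy) h1
    (by convert h2 using 1 <;> ring) (by positivity)
    (by rw [div_le_one hp]; linarith)
  have k2 := InS_mono (t := al + be) (u := ux + be / (al + be) * (wx - ux))
    (v := uy + be / (al + be) * (wy - uy)) h0 (by convert k using 1 <;> ring) hp.le hab
  convert k2 using 1 <;> · field_simp; ring

def StepC (good : (Fin 3 → ℤ) → Prop) (v : Fin 4 → Fin 3 → ℤ) : Prop :=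
  ∃ q, good q ∧ ∃ c : Fin 4 → ℝ, hom4 q = ∑ i, c i • HM v i ∧ ∀ i, c i < 1

theorem StepC_perm {good : (Fin 3 → ℤ) → Prop} {v : Fin 4 → Fin 3 → ℤ} (σ : Equiv.Perm (Fin 4))
    (h : StepC good (v ∘ σ)) : StepC good v := by
  obtain ⟨q, hq, c, hc, hlt⟩ := h
  refine ⟨q, hq, c ∘ σ.symm, ?_, fun i => hlt _⟩
  rw [hc, ← Equiv.sum_comp σ (fun i => (c ∘ σ.symm) i • HM v i)]
  refine Finset.sum_congr rfl fun i _ => ?_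
  simp only [Function.comp, Equiv.symm_apply_apply]; rfl

theorem D3_perm (v : Fin 4 → Fin 3 → ℤ) (σ : Equiv.Perm (Fin 4)) : |D3 (v ∘ σ)| = |D3 v| := by
  have h : HM (v ∘ σ) = (HM v).submatrix σ id := by ext; simp [HM]
  have h2 := Matrix.det_permute σ (HM v)
  rw [← h, HM_det, HM_det] at h2
  have h3 : |(D3 (v ∘ σ) : ℝ)| = |(D3 v : ℝ)| := by
    rw [← abs_neg, h2, abs_mul, abs_neg]
    rcases Int.units_eq_one_or (Equiv.Perm.sign σ) with h | h <;> simp [h]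
  exact_mod_cast h3

theorem D3_formula (v : Fin 4 → Fin 3 → ℤ) : D3 v =
    (v 1 0 - v 0 0) * (v 2 1 - v 0 1) * (v 3 2 - v 0 2) - (v 1 0 - v 0 0) * (v 2 2 - v 0 2) * (v 3 1 - v 0 1)
    - (v 1 1 - v 0 1) * (v 2 0 - v 0 0) * (v 3 2 - v 0 2) + (v 1 1 - v 0 1) * (v 2 2 - v 0 2) * (v 3 0 - v 0 0)
    + (v 1 2 - v 0 2) * (v 2 0 - v 0 0) * (v 3 1 - v 0 1) - (v 1 2 - v 0 2) * (v 2 1 - v 0 1) * (v 3 0 - v 0 0) := by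
  unfold D3
  rw [Matrix.det_fin_three]; simp

theorem hom_eq {v : Fin 4 → Fin 3 → ℤ} {q : Fin 3 → ℤ} {c : Fin 4 → ℝ}
   (h0 : (q 0 : ℝ) = c 0 * v 0 0 + c 1 * v 1 0 + c 2 * v 2 0 + c 3 * v 3 0)
   (h1 : (q 1 : ℝ) = c 0 * v 0 1 + c 1 * v 1 1 + c 2 * v 2 1 + c 3 * v 3 1)
   (h2 : (q 2 : ℝ) = c 0 * v 0 2 + c 1 * v 1 2 + c 2 * v 2 2 + c 3 * v 3 2)
   (h3 : c 0 + c 1 + c 2 + c 3 = 1) : hom4 q = ∑ i, c i • HM v i := by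
  ext i
  fin_cases i <;> simp [hom4, HM, Fin.sum_univ_four, h0, h1, h2, h3]

def Good {ι : Type*} (ax ay bx by' : ι → ℤ) (j : ℤ) (q : Fin 3 → ℤ) : Prop :=
  (q 2 = j ∧ InS (fun i => (bx i : ℝ)) (fun i => (by' i : ℝ)) (q 0) (q 1)) ∨
  (q 2 = j + 1 ∧ InS (fun i => (ax i : ℝ)) (fun i => (ay i : ℝ)) (q 0) (q 1))

theorem step22 {ι : Type*} [Fintype ι] [Nonempty ι] (ax ay bx by' : ι → ℤ)
    (hmax : ∀ p r : ℝ, ∀ i, (∀ l, p * bx l + r * by' l ≤ p * bx i + r * by' i) →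
      ∀ l, p * ax l + r * ay l ≤ p * ax i + r * ay i)
    (hinj : ∀ i j, ax i = ax j → ay i = ay j → i = j) (j : ℤ)
    (v : Fin 4 → Fin 3 → ℤ)
    (h0 : v 0 2 = j ∧ InS (fun i => (bx i : ℝ)) (fun i => (by' i : ℝ)) (v 0 0) (v 0 1))
    (h1 : v 1 2 = j ∧ InS (fun i => (bx i : ℝ)) (fun i => (by' i : ℝ)) (v 1 0) (v 1 1))
    (h2 : v 2 2 = j + 1 ∧ InS (fun i => (ax i : ℝ)) (fun i => (ay i : ℝ)) (v 2 0) (v 2 1))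
    (h3 : v 3 2 = j + 1 ∧ InS (fun i => (ax i : ℝ)) (fun i => (ay i : ℝ)) (v 3 0) (v 3 1))
    (hm : 2 ≤ (v 3 0 - v 2 0) * (v 1 1 - v 0 1) - (v 3 1 - v 2 1) * (v 1 0 - v 0 0)) :
    StepC (Good ax ay bx by' j) v := by
  obtain ⟨m, hmd⟩ : ∃ m, m = (v 3 0 - v 2 0) * (v 1 1 - v 0 1) - (v 3 1 - v 2 1) * (v 1 0 - v 0 0) := ⟨_, rfl⟩
  have hmR : (m : ℝ) = (v 3 0 - v 2 0) * (v 1 1 - v 0 1) - (v 3 1 - v 2 1) * (v 1 0 - v 0 0) := by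
    exact_mod_cast hmd
  rw [← hmd] at hm
  have hm0 : (0:ℝ) < m := by exact_mod_cast (by omega : 0 < m)
  have z0 : (v 0 2 : ℝ) = j := by exact_mod_cast h0.1
  have z1 : (v 1 2 : ℝ) = j := by exact_mod_cast h1.1
  have z2 : (v 2 2 : ℝ) = j + 1 := by exact_mod_cast h2.1
  have z3 : (v 3 2 : ℝ) = j + 1 := by exact_mod_cast h3.1
  rcases core22 ax ay bx by' hmax hinj (v 2 0) (v 2 1) (v 3 0 - v 2 0) (v 3 1 - v 2 1)
    (v 0 0) (v 0 1) (v 1 0 - v 0 0) (v 1 1 - v 0 1) m h2.2 (by push_cast; simpa using h3.2) h0.2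
    (by push_cast; simpa using h1.2) hmd hm with h | h
  · obtain ⟨wx, wy, hin, hX0, hX1, hY0, hY1⟩ := h
    obtain ⟨X, hX⟩ : ∃ X : ℤ, X = wx * (v 1 1 - v 0 1) - wy * (v 1 0 - v 0 0) := ⟨_, rfl⟩
    obtain ⟨Y, hY⟩ : ∃ Y : ℤ, Y = (v 3 0 - v 2 0) * wy - (v 3 1 - v 2 1) * wx := ⟨_, rfl⟩
    rw [← hX] at hX0 hX1
    rw [← hY] at hY0 hY1
    have hXR : (X:ℝ) = wx * (v 1 1 - v 0 1) - wy * (v 1 0 - v 0 0) := by exact_mod_cast hX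
    have hYR : (Y:ℝ) = (v 3 0 - v 2 0) * wy - (v 3 1 - v 2 1) * wx := by exact_mod_cast hY
    have r1 : (0:ℝ) < X := by exact_mod_cast hX0
    have r2 : (X:ℝ) < m := by exact_mod_cast hX1
    have r3 : -(m:ℝ) < Y := by exact_mod_cast hY0
    have r4 : (Y:ℝ) < m := by exact_mod_cast hY1
    refine ⟨![v 2 0 + wx, v 2 1 + wy, j + 1], Or.inr ⟨by simp, by simpa using hin⟩,
      ![-(Y / m), Y / m, 1 - X / m, X / m], hom_eq ?_ ?_ ?_ ?_, ?_⟩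
    · simp; field_simp; rw [hXR, hYR, hmR]; ring
    · simp; field_simp; rw [hXR, hYR, hmR]; ring
    · simp [z0, z1, z2, z3]; field_simp; ring
    · simp
    · have := div_pos r1 hm0
      have := (div_lt_one hm0).mpr r2
      have := (div_lt_one hm0).mpr r4
      have : -(1:ℝ) < Y / m := by rw [lt_div_iff₀ hm0]; linarith
      intro i; fin_cases i <;> simp <;> linarith
  · obtain ⟨wx, wy, hin, hX0, hX1, hY0, hY1⟩ := h
    obtain ⟨X, hX⟩ : ∃ X : ℤ, X = wx * (v 1 1 - v 0 1) - wy * (v 1 0 - v 0 0) := ⟨_, rfl⟩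
    obtain ⟨Y, hY⟩ : ∃ Y : ℤ, Y = (v 3 0 - v 2 0) * wy - (v 3 1 - v 2 1) * wx := ⟨_, rfl⟩
    rw [← hX] at hX0 hX1
    rw [← hY] at hY0 hY1
    have hXR : (X:ℝ) = wx * (v 1 1 - v 0 1) - wy * (v 1 0 - v 0 0) := by exact_mod_cast hX
    have hYR : (Y:ℝ) = (v 3 0 - v 2 0) * wy - (v 3 1 - v 2 1) * wx := by exact_mod_cast hY
    have r1 : (0:ℝ) < Y := by exact_mod_cast hY0
    have r2 : (X:ℝ) < m := by exact_mod_cast hX1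
    have r3 : -(m:ℝ) < X := by exact_mod_cast hX0
    have r4 : (Y:ℝ) < m := by exact_mod_cast hY1
    refine ⟨![v 0 0 + wx, v 0 1 + wy, j], Or.inl ⟨by simp, by simpa using hin⟩,
      ![1 - Y / m, Y / m, -(X / m), X / m], hom_eq ?_ ?_ ?_ ?_, ?_⟩
    · simp; field_simp; rw [hXR, hYR, hmR]; ring
    · simp; field_simp; rw [hXR, hYR, hmR]; ring
    · simp [z0, z1, z2, z3]; field_simp; ring
    · simp
    · have := div_pos r1 hm0
      have := (div_lt_one hm0).mpr r2
      have := (div_lt_one hm0).mpr r4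
      have : -(1:ℝ) < X / m := by rw [lt_div_iff₀ hm0]; linarith
      intro i; fin_cases i <;> simp <;> linarith

theorem step {ι : Type*} [Fintype ι] [Nonempty ι] (ax ay bx by' : ι → ℤ)
    (hmax : ∀ p r : ℝ, ∀ i, (∀ l, p * bx l + r * by' l ≤ p * bx i + r * by' i) →
      ∀ l, p * ax l + r * ay l ≤ p * ax i + r * ay i)
    (hinj : ∀ i j, ax i = ax j → ay i = ay j → i = j) (j : ℤ)
    (v : Fin 4 → Fin 3 → ℤ) (hg : ∀ i, Good ax ay bx by' j (v i)) (hD : 2 ≤ |D3 v|) :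
    StepC (Good ax ay bx by' j) v := by
  let σ := Tuple.sort (fun i => v i 2)
  have hmono := Tuple.monotone_sort (fun i => v i 2)
  apply StepC_perm σ
  rw [← D3_perm v σ] at hD
  have hg' : ∀ i, Good ax ay bx by' j ((v ∘ σ) i) := fun i => hg _
  have m01 : (v ∘ σ) 0 2 ≤ (v ∘ σ) 1 2 := hmono (by decide : (0 : Fin 4) ≤ 1)
  have m12 : (v ∘ σ) 1 2 ≤ (v ∘ σ) 2 2 := hmono (by decide : (1 : Fin 4) ≤ 2)
  have m23 : (v ∘ σ) 2 2 ≤ (v ∘ σ) 3 2 := hmono (by decide : (2 : Fin 4) ≤ 3)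
  generalize v ∘ σ = v at *
  clear hg hmono σ
  have hD2 := hD
  rw [D3_formula] at hD
  rcases hg' 0 with h0 | h0
  swap
  · exfalso
    have e1 : v 1 2 = j + 1 := by rcases hg' 1 with h | h <;> omega
    have e2 : v 2 2 = j + 1 := by rcases hg' 2 with h | h <;> omega
    have e3 : v 3 2 = j + 1 := by rcases hg' 3 with h | h <;> omega
    rw [e1, e2, e3, h0.1] at hD
    simp at hD
  rcases hg' 3 with h3 | h3
  · exfalso
    have e1 : v 1 2 = j := by rcases hg' 1 with h | h <;> omega
    have e2 : v 2 2 = j := by rcases hg' 2 with h | h <;> omega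
    rw [e1, e2, h3.1, h0.1] at hD
    simp at hD
  rcases hg' 1 with h1 | h1
  · rcases hg' 2 with h2 | h2
    · rw [h0.1, h1.1, h2.1, h3.1] at hD
      obtain ⟨zx, zy, al, be, a1, a2, b1, b2, ab1, ab2, hx, hy⟩ := tri_pt (v 1 0 - v 0 0) (v 1 1 - v 0 1) (v 2 0 - v 0 0) (v 2 1 - v 0 1) _ rfl
        (by convert hD using 2; ring)
      have z0 : (v 0 2 : ℝ) = j := by exact_mod_cast h0.1
      have z1 : (v 1 2 : ℝ) = j := by exact_mod_cast h1.1
      have z2 : (v 2 2 : ℝ) = j := by exact_mod_cast h2.1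
      refine ⟨![v 0 0 + zx, v 0 1 + zy, j], Or.inl ⟨by simp, ?_⟩, ![1 - al - be, al, be, 0], hom_eq ?_ ?_ ?_ ?_, ?_⟩
      · have := InS_tri (ux := ((v 1 0 - v 0 0 : ℤ) : ℝ)) (uy := ((v 1 1 - v 0 1 : ℤ) : ℝ))
          (wx := ((v 2 0 - v 0 0 : ℤ) : ℝ)) (wy := ((v 2 1 - v 0 1 : ℤ) : ℝ)) h0.2
          (by push_cast; simpa using h1.2) (by push_cast; simpa using h2.2) a1 b1 ab1 ab2
        rw [← hx, ← hy] at this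
        simpa using this
      · simp [hx]; ring
      · simp [hy]; ring
      · simp [z0, z1, z2]; ring
      · simp; ring
      · intro i; fin_cases i <;> simp <;> linarith
    · rcases le_total 0 ((v 3 0 - v 2 0) * (v 1 1 - v 0 1) - (v 3 1 - v 2 1) * (v 1 0 - v 0 0)) with hs | hs
      · refine step22 ax ay bx by' hmax hinj j v h0 h1 h2 h3 ?_
        rw [h0.1, h1.1, h2.1, h3.1] at hD
        rw [← abs_of_nonneg hs]
        convert hD using 2; ring
      · apply StepC_perm (Equiv.swap 2 3)
        refine step22 ax ay bx by' hmax hinj j _ h0 h1 ?_ ?_ ?_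
        · simpa using h3
        · simpa using h2
        · rw [h0.1, h1.1, h2.1, h3.1] at hD
          rw [show (v ∘ Equiv.swap (2 : Fin 4) 3) 0 = v 0 from rfl, show (v ∘ Equiv.swap (2 : Fin 4) 3) 1 = v 1 from rfl,
            show (v ∘ Equiv.swap (2 : Fin 4) 3) 2 = v 3 from rfl, show (v ∘ Equiv.swap (2 : Fin 4) 3) 3 = v 2 from rfl]
          rw [show (v 2 0 - v 3 0) * (v 1 1 - v 0 1) - (v 2 1 - v 3 1) * (v 1 0 - v 0 0) = -((v 3 0 - v 2 0) * (v 1 1 - v 0 1) - (v 3 1 - v 2 1) * (v 1 0 - v 0 0)) by ring, ← abs_of_nonpos hs]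
          convert hD using 2; ring
  · have h2 : v 2 2 = j + 1 ∧ InS (fun i => (ax i : ℝ)) (fun i => (ay i : ℝ)) (v 2 0) (v 2 1) := by
      rcases hg' 2 with h | h
      · omega
      · exact h
    rw [h0.1, h1.1, h2.1, h3.1] at hD
    obtain ⟨zx, zy, al, be, a1, a2, b1, b2, ab1, ab2, hx, hy⟩ := tri_pt (v 2 0 - v 1 0) (v 2 1 - v 1 1) (v 3 0 - v 1 0) (v 3 1 - v 1 1) _ rfl
      (by convert hD using 2; ring)
    have z1 : (v 1 2 : ℝ) = j + 1 := by exact_mod_cast h1.1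
    have z2 : (v 2 2 : ℝ) = j + 1 := by exact_mod_cast h2.1
    have z3 : (v 3 2 : ℝ) = j + 1 := by exact_mod_cast h3.1
    refine ⟨![v 1 0 + zx, v 1 1 + zy, j + 1], Or.inr ⟨by simp, ?_⟩, ![0, 1 - al - be, al, be], hom_eq ?_ ?_ ?_ ?_, ?_⟩
    · have := InS_tri (ux := ((v 2 0 - v 1 0 : ℤ) : ℝ)) (uy := ((v 2 1 - v 1 1 : ℤ) : ℝ))
        (wx := ((v 3 0 - v 1 0 : ℤ) : ℝ)) (wy := ((v 3 1 - v 1 1 : ℤ) : ℝ)) h1.2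
        (by push_cast; simpa using h2.2) (by push_cast; simpa using h3.2) a1 b1 ab1 ab2
      rw [← hx, ← hy] at this
      simpa using this
    · simp [hx]; ring
    · simp [hy]; ring
    · simp [z1, z2, z3]; ring
    · simp; ring
    · intro i; fin_cases i <;> simp <;> linarith

theorem slab {ι : Type*} [Fintype ι] [Nonempty ι] (ax ay bx by' : ι → ℤ)
    (hmax : ∀ p r : ℝ, ∀ i, (∀ l, p * bx l + r * by' l ≤ p * bx i + r * by' i) →
      ∀ l, p * ax l + r * ay l ≤ p * ax i + r * ay i)
    (hinj : ∀ i j, ax i = ax j → ay i = ay j → i = j)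
    (hnc : ∀ p r : ℝ, (∀ i j, p * (bx i : ℝ) + r * (by' i : ℝ) = p * bx j + r * by' j) → p = 0 ∧ r = 0)
    (j : ℤ) (x y z : ℝ) (w w' : ι → ℝ) (hw : ∀ i, 0 ≤ w i) (hw' : ∀ i, 0 ≤ w' i)
    (hx : x = ∑ i, w i * bx i + ∑ i, w' i * ax i)
    (hy : y = ∑ i, w i * by' i + ∑ i, w' i * ay i)
    (hz : z = ∑ i, w i * j + ∑ i, w' i * (j + 1))
    (h1 : ∑ i, w i + ∑ i, w' i = 1) :
    ∃ v : Fin 4 → Fin 3 → ℤ, (∀ i, Good ax ay bx by' j (v i)) ∧ (D3 v = 1 ∨ D3 v = -1) ∧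
     (![x, y, z] : Fin 3 → ℝ) ∈ convexHull ℝ {(fun i => (v 0 i : ℝ)), (fun i => (v 1 i : ℝ)), (fun i => (v 2 i : ℝ)), (fun i => (v 3 i : ℝ))} := by
  let pt : ι ⊕ ι → Fin 3 → ℤ := Sum.elim (fun i => ![bx i, by' i, j]) (fun i => ![ax i, ay i, j + 1])
  obtain ⟨v0, hv0, hD0⟩ := exists_T0 pt (by
    intro p r s t h
    have hb : ∀ i, p * (bx i : ℝ) + r * by' i + s * j + t = 0 := fun i => by simpa [pt] using h (Sum.inl i)
    have ha : ∀ i, p * (ax i : ℝ) + r * ay i + s * (j + 1) + t = 0 := fun i => by simpa [pt] using h (Sum.inr i)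
    obtain ⟨rfl, rfl⟩ := hnc p r (fun i j => by linarith [hb i, hb j])
    have i0 : ι := Classical.arbitrary ι
    have := hb i0; have := ha i0
    refine ⟨rfl, rfl, by linarith, ?_⟩
    have : s = 0 := by linarith
    subst this
    linarith)
  obtain ⟨v1, hv1, hD1, hin⟩ := init_tet pt v0 hv0 hD0 (Sum.elim w w') (by
    rintro (i | i)
    · exact hw i
    · exact hw' i) Finset.univ
  have e : ∑ k, (Sum.elim w w' k) • hom4 (pt k) = ![x, y, z, 1] := by
    ext i
    fin_cases i <;> simp [hom4, pt, hx, hy, hz, h1]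
  rw [e] at hin
  obtain ⟨v, hv, hD, hin⟩ := descent (Good ax ay bx by' j) (fun v h1 h2 => step ax ay bx by' hmax hinj j v h1 h2)
    _ _ v1 (by
      intro i
      obtain ⟨k, hk⟩ := hv1 i
      rw [← hk]
      rcases k with k | k
      · exact Or.inl ⟨by simp [pt], fun p r => ⟨k, by simp [pt]⟩⟩
      · exact Or.inr ⟨by simp [pt], fun p r => ⟨k, by simp [pt]⟩⟩) hD1 rfl hin
  exact ⟨v, hv, hD, InT_hull v x y z hin⟩


theorem edge_of_ext {P Z : Set (Fin 3 → ℝ)} (hP : IsCompact P) (v : Fin 3 → ℝ)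
    (hv : v ∈ P.extremePoints ℝ) (g : StrongDual ℝ (Fin 3 → ℝ))
    (hZ1 : ∀ z ∈ Z, g z = 1) (hZ2 : ∀ a ∈ P, ∃ al : ℝ, 0 ≤ al ∧ ∃ z ∈ Z, a - v = al • z)
    (y : Fin 3 → ℝ) (hy : y ∈ Z.extremePoints ℝ) (hyP : ∃ t : ℝ, 0 < t ∧ v + t • y ∈ P)
    (hconv : Convex ℝ P) :
    ∃ T : ℝ, 0 < T ∧ IsEdge P v (v + T • y) := by
  obtain ⟨t, ht, htP⟩ := hyP
  have gy : g y = 1 := hZ1 y hy.1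
  have hcl : IsClosed {x : Fin 3 → ℝ | x - v = g (x - v) • y} :=
    isClosed_eq (by fun_prop) (by fun_prop)
  obtain ⟨w, hw, hmax⟩ := (hP.inter_right hcl).exists_isMaxOn (f := fun x => g x)
    ⟨v + t • y, htP, by simp [gy]⟩ (by fun_prop)
  have hT : t ≤ g (w - v) := by
    have := hmax (show v + t • y ∈ _ from ⟨htP, by simp [gy]⟩)
    simp [gy] at this
    simp; linarith
  have hwv : w = v + g (w - v) • y := by
    have := hw.2
    simp only [Set.mem_setOf_eq] at this
    rw [← this]; simp
  refine ⟨g (w - v), by linarith, ?_⟩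
  rw [← hwv]
  set T := g (w - v) with hTd
  have hT0 : 0 < T := by linarith
  have hy0 : y ≠ 0 := by rintro rfl; simp at gy
  refine ⟨fun h => ?_, ?_, ?_⟩
  · rw [← h] at hTd; simp at hTd; linarith
  · exact hconv.segment_subset hv.1 hw.1
  · -- extreme
    have memseg : ∀ al : ℝ, 0 ≤ al → v + al • y ∈ P → v + al • y ∈ segment ℝ v w := by
      intro al h0 hal
      have hle : al ≤ T := by
        have := hmax (show v + al • y ∈ _ from ⟨hal, by simp [gy]⟩)
        simp [gy] at this
        rw [hTd]; simp; linarith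
      rw [segment_eq_image']
      refine ⟨al / T, ⟨by positivity, by rw [div_le_one hT0]; exact hle⟩, ?_⟩
      have : w - v = T • y := hw.2
      simp only [this, smul_smul]
      rw [div_mul_cancel₀ _ hT0.ne']
    intro a ha b hb x hx hxo
    obtain ⟨al, hal, za, hza, hae⟩ := hZ2 a ha
    obtain ⟨be, hbe, zb, hzb, hbeq⟩ := hZ2 b hb
    have ha' : a = v + al • za := by rw [← hae]; simp
    have hb' : b = v + be • zb := by rw [← hbeq]; simp
    rcases hal.eq_or_lt with h | hal
    · rw [ha', ← h]; simp [left_mem_segment]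
    by_cases hxv : x = v
    · subst hxv
      rw [hv.2 ha hb hxo]; exact left_mem_segment _ _ _
    obtain ⟨p, q, hp, hq, hpq, hx2⟩ := hxo
    rw [segment_eq_image'] at hx
    obtain ⟨θ, ⟨hθ0, hθ1⟩, hx1⟩ := hx
    have hwT : w - v = T • y := hw.2
    have e : (θ * T) • y = (p * al) • za + (q * be) • zb := by
      have : x - v = p • (a - v) + q • (b - v) := by
        rw [← hx2, smul_sub, smul_sub]
        have : v = (p + q) • v := by rw [hpq, one_smul]
        nth_rewrite 1 [this]; rw [add_smul]; abel
      rw [hae, hbeq] at this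
      rw [← smul_smul, ← smul_smul, ← smul_smul, ← this, ← hwT, ← hx1]; simp
    have hs : θ * T = p * al + q * be := by
      have := congrArg g e
      simpa [gy, hZ1 za hza, hZ1 zb hzb] using this
    have hpos : 0 < θ * T := by rw [hs]; have := mul_pos hp hal; have := mul_nonneg hq.le hbe; linarith
    have hzy : za = y := by
      rcases hbe.eq_or_lt with h | hbe
      · rw [← h] at e hs
        simp at e hs
        rw [hs] at e
        exact ((smul_right_injective _ (mul_pos hp hal).ne') e).symm
      · apply hy.2 hza hzb
        refine ⟨p * al / (θ * T), q * be / (θ * T), by positivity, by positivity, ?_, ?_⟩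
        · rw [← add_div, ← hs, div_self hpos.ne']
        · apply smul_right_injective _ hpos.ne'
          simp only [smul_add, smul_smul]
          rw [mul_div_cancel₀ _ hpos.ne', mul_div_cancel₀ _ hpos.ne', e]
    rw [ha', hzy]
    exact memseg al hal.le (by rw [← hzy, ← ha']; exact ha)

theorem cone_lemma (S : Set (Fin 3 → ℝ)) (hS : S.Finite) (v : Fin 3 → ℝ)
    (hv : v ∈ (convexHull ℝ S).extremePoints ℝ) (w : Fin 3 → Fin 3 → ℝ)
    (hE : {x | IsEdge (convexHull ℝ S) v x} ⊆ {w 0, w 1, w 2}) (x : Fin 3 → ℝ)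
    (hx : x ∈ convexHull ℝ S) :
    ∃ c : Fin 3 → ℝ, (∀ i, 0 ≤ c i) ∧ x - v = ∑ i, c i • (w i - v) := by
  by_cases hne : (S \ {v}).Nonempty
  swap
  · have hs : S ⊆ {v} := by
      intro s hs
      by_contra h
      exact hne ⟨s, hs, h⟩
    have : x ∈ ({v} : Set (Fin 3 → ℝ)) := convexHull_min hs (convex_singleton v) hx
    rw [this]
    exact ⟨0, by simp, by simp⟩
  have hv2 := ((convex_convexHull ℝ S).mem_extremePoints_iff_mem_sdiff_convexHull_sdiff).mp hv
  have hvn : v ∉ convexHull ℝ (S \ {v}) := fun h => hv2.2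
    (convexHull_mono (Set.diff_subset_diff_left (subset_convexHull ℝ S)) h)
  obtain ⟨g, u, hgv, hgs⟩ := geometric_hahn_banach_point_closed (convex_convexHull ℝ _)
    ((hS.subset Set.diff_subset).isClosed_convexHull ℝ) hvn
  have hg : ∀ s ∈ S \ {v}, 0 < g (s - v) := by
    intro s hs
    have := hgs s (subset_convexHull ℝ _ hs)
    simp; linarith
  set Y : Set (Fin 3 → ℝ) := (fun s => (g (s - v))⁻¹ • (s - v)) '' (S \ {v}) with hY
  have hYf : Y.Finite := (hS.subset Set.diff_subset).image _
  set Zs := convexHull ℝ Y with hZ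
  have hZ1 : ∀ z ∈ Zs, g z = 1 := by
    have : Zs ⊆ {z | g z = 1} := by
      apply convexHull_min
      · rintro _ ⟨s, hs, rfl⟩
        simp only [Set.mem_setOf_eq, map_smul, smul_eq_mul]
        exact inv_mul_cancel₀ (hg s hs).ne'
      · exact convex_hyperplane g.toLinearMap.isLinear 1
    exact fun z hz => this hz
  have hZne : Zs.Nonempty := by rw [hZ, convexHull_nonempty_iff]; exact hne.image _
  obtain ⟨z0, hz0⟩ := hZne
  have hZ2 : ∀ a ∈ convexHull ℝ S, ∃ al : ℝ, 0 ≤ al ∧ ∃ z ∈ Zs, a - v = al • z := by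
    have : convexHull ℝ S ⊆ {a | ∃ al : ℝ, 0 ≤ al ∧ ∃ z ∈ Zs, a - v = al • z} := by
      apply convexHull_min
      · intro s hs
        by_cases h : s = v
        · exact ⟨0, le_rfl, z0, hz0, by simp [h]⟩
        · have hs' : s ∈ S \ {v} := ⟨hs, h⟩
          refine ⟨g (s - v), (hg s hs').le, _, subset_convexHull ℝ _ ⟨s, hs', rfl⟩, ?_⟩
          simp only [smul_smul]
          rw [mul_inv_cancel₀ (hg s hs').ne', one_smul]
      · rintro a ⟨al, hal, z, hz, ha⟩ b ⟨be, hbe, z', hz', hb⟩ p q hp hq hpq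
        have e : p • a + q • b - v = (p * al) • z + (q * be) • z' := by
          rw [mul_smul, mul_smul, ← ha, ← hb, smul_sub, smul_sub]
          have : v = (p + q) • v := by rw [hpq, one_smul]
          nth_rewrite 1 [this]; rw [add_smul]; abel
        have h1 := mul_nonneg hp hal
        have h2 := mul_nonneg hq hbe
        rcases (add_nonneg h1 h2).eq_or_lt with h | h
        · refine ⟨0, le_rfl, z, hz, ?_⟩
          rw [e, show p * al = 0 by linarith, show q * be = 0 by linarith]; simp
        · refine ⟨p * al + q * be, h.le, (p * al / (p * al + q * be)) • z + (q * be / (p * al + q * be)) • z', ?_, ?_⟩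
          · exact convex_convexHull ℝ Y hz hz' (by positivity) (by positivity) (by rw [← add_div, div_self h.ne'])
          · rw [e, smul_add, smul_smul, smul_smul, mul_div_cancel₀ _ h.ne', mul_div_cancel₀ _ h.ne']
    exact fun a ha => this ha
  have hK : Convex ℝ {y : Fin 3 → ℝ | ∃ c : Fin 3 → ℝ, (∀ i, 0 ≤ c i) ∧ y = ∑ i, c i • (w i - v)} := by
    rintro a ⟨c, hc, ha⟩ b ⟨d, hd, hb⟩ p q hp hq hpq
    refine ⟨fun i => p * c i + q * d i, fun i => by have := hc i; have := hd i; positivity, ?_⟩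
    rw [ha, hb]
    simp only [Finset.smul_sum, add_smul, Finset.sum_add_distrib, mul_smul]
  have hext : Zs.extremePoints ℝ ⊆ {y : Fin 3 → ℝ | ∃ c : Fin 3 → ℝ, (∀ i, 0 ≤ c i) ∧ y = ∑ i, c i • (w i - v)} := by
    intro y hy
    have hyY : y ∈ Y := extremePoints_convexHull_subset hy
    obtain ⟨s, hs, hsy⟩ := hyY
    obtain ⟨T, hT, hedge⟩ := edge_of_ext (hS.isCompact_convexHull ℝ) v hv g hZ1 hZ2 y hy
      ⟨g (s - v), hg s hs, by
        rw [← hsy]; simp only [smul_smul]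
        rw [mul_inv_cancel₀ (hg s hs).ne', one_smul]
        simpa using subset_convexHull ℝ S hs.1⟩ (convex_convexHull ℝ S)
    have hi : ∃ i, v + T • y = w i := by
      rcases hE hedge with h | h | h
      · exact ⟨0, h⟩
      · exact ⟨1, h⟩
      · exact ⟨2, h⟩
    obtain ⟨i, hi⟩ := hi
    refine ⟨Pi.single i T⁻¹, ?_, ?_⟩
    · intro j
      by_cases h : j = i
      · subst h; simp; positivity
      · simp [h]
    · rw [Finset.sum_eq_single i]
      · rw [← hi]; simp [smul_smul, inv_mul_cancel₀ hT.ne']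
      · intro j _ h; simp [h]
      · simp
  have hZsub : Zs ⊆ {y : Fin 3 → ℝ | ∃ c : Fin 3 → ℝ, (∀ i, 0 ≤ c i) ∧ y = ∑ i, c i • (w i - v)} := by
    have h1 := closure_convexHull_extremePoints (hYf.isCompact_convexHull ℝ) (convex_convexHull ℝ Y)
    have h2 : IsClosed (convexHull ℝ ((convexHull ℝ Y).extremePoints ℝ)) :=
      (hYf.subset extremePoints_convexHull_subset).isClosed_convexHull ℝ
    rw [h2.closure_eq] at h1
    rw [hZ, ← h1]
    exact convexHull_min hext hK
  obtain ⟨al, hal, z, hz, hxe⟩ := hZ2 x hx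
  obtain ⟨c, hc, hze⟩ := hZsub hz
  refine ⟨fun i => al * c i, fun i => mul_nonneg hal (hc i), ?_⟩
  rw [hxe, hze, Finset.smul_sum]
  simp only [smul_smul]


theorem right_ext {P : Set (Fin 3 → ℝ)} {v w : Fin 3 → ℝ} (h : IsExtreme ℝ P (segment ℝ v w)) (hvw : v ≠ w) :
    w ∈ P.extremePoints ℝ := by
  apply h.extremePoints_subset_extremePoints
  refine ⟨right_mem_segment _ _ _, ?_⟩
  intro a ha b hb hw
  rw [segment_eq_image'] at ha hb
  obtain ⟨α, ⟨ha0, ha1⟩, rfl⟩ := ha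
  obtain ⟨β, ⟨hb0, hb1⟩, rfl⟩ := hb
  obtain ⟨p, q, hp, hq, hpq, e⟩ := hw
  have e2 : (p * α + q * β - 1) • (w - v) = 0 := by
    simp only at e
    have h1 : (p * α + q * β - 1) • (w - v) = (p • (v + α • (w - v)) + q • (v + β • (w - v)) - w) - (p + q - 1) • v := by module
    rw [h1, e, hpq]; simp
  have hne : w - v ≠ 0 := sub_ne_zero.mpr hvw.symm
  have h3 := (smul_eq_zero.mp e2).resolve_right hne
  have hα : α = 1 := by
    have h4 : p * (1 - α) + q * (1 - β) = 0 := by linear_combination hpq - h3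
    have h5 := mul_nonneg hp.le (by linarith : 0 ≤ 1 - α)
    have h6 := mul_nonneg hq.le (by linarith : 0 ≤ 1 - β)
    have h7 : p * (1 - α) = 0 := by linarith
    have := (mul_eq_zero.mp h7).resolve_left hp.ne'
    linarith
  simp [hα]

theorem vertex_struct (S : Set (Fin 3 → ℝ)) (hS : S.Finite) (hsm : IsSmooth (convexHull ℝ S))
    (v : Fin 3 → ℝ) (hv : v ∈ (convexHull ℝ S).extremePoints ℝ) (ε : ℤ) (hε : ε = 1 ∨ ε = -1)
    (hh : ∀ x ∈ convexHull ℝ S, 0 ≤ (ε : ℝ) * (x 2 - v 2))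
    (hnc : ∀ p r C : ℝ, (∀ x ∈ convexHull ℝ S, x 2 = v 2 → p * x 0 + r * x 1 = C) → p = 0 ∧ r = 0) :
    ∃ (δ : Fin 3 → ℤ) (t : ℝ), δ 2 = ε ∧ 0 < t ∧ IsEdge (convexHull ℝ S) v (v + t • toR3 δ) ∧
      (∀ x, IsEdge (convexHull ℝ S) v x → x 2 ≠ v 2 → x = v + t • toR3 δ) ∧
      (∀ p r : ℝ, (∀ x ∈ convexHull ℝ S, x 2 = v 2 → p * x 0 + r * x 1 ≤ p * v 0 + r * v 1) →
        ∀ x ∈ convexHull ℝ S, p * x 0 + r * x 1 ≤ p * v 0 + r * v 1 + (p * δ 0 + r * δ 1) * (ε * (x 2 - v 2))) := by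
  obtain ⟨w, hinj, hE, d, hd, hdet⟩ := hsm v hv
  have hwE : ∀ i, IsEdge (convexHull ℝ S) v (w i) := by
    intro i
    have : w i ∈ ({w 0, w 1, w 2} : Set _) := by fin_cases i <;> simp
    rw [← hE] at this
    exact this
  have hwP : ∀ i, w i ∈ convexHull ℝ S := fun i => (hwE i).2.subset (right_mem_segment _ _ _)
  choose hprim t ht hwt using hd
  have hwc : ∀ i j, w i j - v j = t i * d i j := by
    intro i j
    have := congrFun (hwt i) j
    simpa [toR3] using this
  have cone : ∀ x ∈ convexHull ℝ S, ∃ c : Fin 3 → ℝ, (∀ i, 0 ≤ c i) ∧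
      ∀ j, x j - v j = c 0 * (t 0 * d 0 j) + c 1 * (t 1 * d 1 j) + c 2 * (t 2 * d 2 j) := by
    intro x hx
    obtain ⟨c, hc, he⟩ := cone_lemma S hS v hv w hE.le x hx
    refine ⟨c, hc, fun j => ?_⟩
    have := congrFun he j
    simp only [Pi.sub_apply, Finset.sum_apply, Fin.sum_univ_three, Pi.smul_apply, smul_eq_mul, hwc] at this
    exact this
  have hη : ∀ i, 0 ≤ ε * d i 2 := by
    intro i
    have h1 := hh _ (hwP i)
    rw [hwc i 2] at h1
    have h2 : 0 ≤ (ε * d i 2 : ℝ) := by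
      by_contra hcon
      push Not at hcon
      nlinarith [ht i]
    exact_mod_cast h2
  have hdt : d 0 2 * (d 1 0 * d 2 1 - d 1 1 * d 2 0) + d 1 2 * (d 2 0 * d 0 1 - d 2 1 * d 0 0) + d 2 2 * (d 0 0 * d 1 1 - d 0 1 * d 1 0) = 1 ∨
     d 0 2 * (d 1 0 * d 2 1 - d 1 1 * d 2 0) + d 1 2 * (d 2 0 * d 0 1 - d 2 1 * d 0 0) + d 2 2 * (d 0 0 * d 1 1 - d 0 1 * d 1 0) = -1 := by
    rw [Matrix.det_fin_three] at hdet
    simp at hdet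
    rcases hdet with h | h
    · left; linarith
    · right; linarith
  -- two nonhorizontal is impossible
  have two : ∀ l : Fin 3, ¬ (∀ i, i ≠ l → d i 2 ≠ 0) := by
    intro l hl
    have key : ∀ x ∈ convexHull ℝ S, x 2 = v 2 → ∃ c : ℝ, ∀ j, x j - v j = c * d l j := by
      intro x hx hx2
      obtain ⟨c, hc, he⟩ := cone x hx
      have h2 := he 2
      rw [hx2, sub_self] at h2
      have hterm : ∀ i, 0 ≤ c i * (t i * (ε * d i 2)) := by
        intro i
        have : (0:ℝ) ≤ ε * d i 2 := by exact_mod_cast hη i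
        have := hc i; have := (ht i).le
        positivity
      have hsum : c 0 * (t 0 * (ε * d 0 2)) + c 1 * (t 1 * (ε * d 1 2)) + c 2 * (t 2 * (ε * d 2 2)) = 0 := by
        linear_combination -(ε : ℝ) * h2
      have hz : ∀ i, i ≠ l → c i = 0 := by
        intro i hi
        have h0 : c i * (t i * (ε * d i 2)) = 0 := by
          have q0 := hterm 0
          have q1 := hterm 1
          have q2 := hterm 2
          have r0 : c 0 * (t 0 * (ε * d 0 2)) = 0 := by linarith
          have r1 : c 1 * (t 1 * (ε * d 1 2)) = 0 := by linarith
          have r2 : c 2 * (t 2 * (ε * d 2 2)) = 0 := by linarith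
          fin_cases i
          · exact r0
          · exact r1
          · exact r2
        have hεR : (ε : ℝ) ≠ 0 := by rcases hε with h | h <;> simp [h]
        have hdR : (d i 2 : ℝ) ≠ 0 := by exact_mod_cast hl i hi
        exact (mul_eq_zero.mp h0).resolve_right (mul_ne_zero (ht i).ne' (mul_ne_zero hεR hdR))
      refine ⟨c l * t l, fun j => ?_⟩
      rw [he j]
      fin_cases l
      · have a := hz 1 (by decide)
        have b := hz 2 (by decide)
        rw [a, b]
        show _ = c 0 * t 0 * (d 0 j : ℝ)
        ring
      · have a := hz 0 (by decide)
        have b := hz 2 (by decide)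
        rw [a, b]
        show _ = c 1 * t 1 * (d 1 j : ℝ)
        ring
      · have a := hz 0 (by decide)
        have b := hz 1 (by decide)
        rw [a, b]
        show _ = c 2 * t 2 * (d 2 j : ℝ)
        ring
    have h1 := hnc (-(d l 1)) (d l 0) (-(d l 1) * v 0 + d l 0 * v 1) (by
      intro x hx hx2
      obtain ⟨c, hc⟩ := key x hx hx2
      linear_combination (-(d l 1 : ℝ)) * hc 0 + (d l 0 : ℝ) * hc 1)
    have h2 := hnc 1 0 (v 0) (by
      intro x hx hx2
      obtain ⟨c, hc⟩ := key x hx hx2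
      have := hc 0
      rw [h1.2] at this
      linarith)
    exact one_ne_zero h2.1
  obtain ⟨c, hc, hc2⟩ : ∃ c, d c 2 ≠ 0 ∧ ∀ i, i ≠ c → d i 2 = 0 := by
    by_cases h0 : d 0 2 = 0
    · by_cases h1 : d 1 2 = 0
      · refine ⟨2, ?_, ?_⟩
        · intro h; rw [h0, h1, h] at hdt; simp at hdt
        · intro i hi; fin_cases i
          · exact h0
          · exact h1
          · exact absurd rfl hi
      · by_cases h2 : d 2 2 = 0
        · refine ⟨1, h1, ?_⟩
          intro i hi; fin_cases i
          · exact h0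
          · exact absurd rfl hi
          · exact h2
        · exfalso; apply two 0
          intro i hi; fin_cases i
          · exact absurd rfl hi
          · exact h1
          · exact h2
    · by_cases h1 : d 1 2 = 0
      · by_cases h2 : d 2 2 = 0
        · refine ⟨0, h0, ?_⟩
          intro i hi; fin_cases i
          · exact absurd rfl hi
          · exact h1
          · exact h2
        · exfalso; apply two 1
          intro i hi; fin_cases i
          · exact h0
          · exact absurd rfl hi
          · exact h2
      · exfalso; apply two 2
        intro i hi; fin_cases i
        · exact h0
        · exact h1
        · exact absurd rfl hi
  have hunit : d c 2 = 1 ∨ d c 2 = -1 := by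
    have : d c 2 ∣ 1 := by
      have h3 : ∃ M, d c 2 * M = 1 ∨ d c 2 * M = -1 := by
        fin_cases c
        · have a := hc2 1 (by decide); have b := hc2 2 (by decide)
          rw [a, b] at hdt; simp only [zero_mul, add_zero] at hdt; exact ⟨_, hdt⟩
        · have a := hc2 0 (by decide); have b := hc2 2 (by decide)
          rw [a, b] at hdt; simp only [zero_mul, add_zero, zero_add] at hdt; exact ⟨_, hdt⟩
        · have a := hc2 0 (by decide); have b := hc2 1 (by decide)
          rw [a, b] at hdt; simp only [zero_mul, add_zero, zero_add] at hdt; exact ⟨_, hdt⟩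
      obtain ⟨M, h | h⟩ := h3
      · exact ⟨M, h.symm⟩
      · exact ⟨-M, by linarith⟩
    exact Int.isUnit_iff.mp (isUnit_of_dvd_one this)
  have hdc : d c 2 = ε := by
    have := hη c
    rcases hunit with h | h <;> rcases hε with h' | h' <;> rw [h, h'] at this ⊢ <;> omega
  have hwcv : v + t c • toR3 (d c) = w c := by rw [← hwt c]; simp
  have hεε : (ε : ℝ) * ε = 1 := by rcases hε with h | h <;> simp [h]
  refine ⟨d c, t c, hdc, ht c, by rw [hwcv]; exact hwE c, ?_, ?_⟩
  · intro x hx hx2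
    have hx' : x ∈ ({w 0, w 1, w 2} : Set _) := by rw [← hE]; exact hx
    have : ∃ i, x = w i := by
      rcases hx' with h | h | h
      · exact ⟨0, h⟩
      · exact ⟨1, h⟩
      · exact ⟨2, h⟩
    obtain ⟨i, rfl⟩ := this
    by_cases hi : i = c
    · rw [hwcv, hi]
    · exfalso; apply hx2
      have := hwc i 2
      rw [hc2 i hi] at this
      simp at this
      linarith
  · intro p r hmax x hx
    obtain ⟨b, hb, he⟩ := cone x hx
    have hF : ∀ i, p * (t i * d i 0) + r * (t i * d i 1) - (p * d c 0 + r * d c 1) * (ε * (t i * d i 2)) ≤ 0 := by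
      intro i
      by_cases hi : i = c
      · subst hi
        rw [hdc]
        have : (ε : ℝ) * (t i * ε) = t i := by linear_combination t i * hεε
        rw [this]
        apply le_of_eq; ring
      · have h1 := hmax (w i) (hwP i) (by
          have := hwc i 2
          rw [hc2 i hi] at this
          simp at this
          linarith)
        rw [hc2 i hi, ← hwc, ← hwc]
        simp; linarith
    have h0 := mul_nonneg (hb 0) (neg_nonneg.mpr (hF 0))
    have h1 := mul_nonneg (hb 1) (neg_nonneg.mpr (hF 1))
    have h2 := mul_nonneg (hb 2) (neg_nonneg.mpr (hF 2))
    have k : p * (x 0 - v 0) + r * (x 1 - v 1) - (p * d c 0 + r * d c 1) * (ε * (x 2 - v 2)) ≤ 0 := by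
      rw [he 0, he 1, he 2]; linarith
    linarith

theorem face_max (S : Set (Fin 3 → ℝ)) (hS : S.Finite)
    (hh : ∀ x ∈ convexHull ℝ S, 0 ≤ x 2) (h0 : ∃ x ∈ convexHull ℝ S, x 2 = 0) (p r : ℝ) :
    ∃ v ∈ (convexHull ℝ S).extremePoints ℝ, v 2 = 0 ∧
      ∀ x ∈ convexHull ℝ S, x 2 = 0 → p * x 0 + r * x 1 ≤ p * v 0 + r * v 1 := by
  have hP := hS.isCompact_convexHull ℝ
  have hc : IsClosed {x : Fin 3 → ℝ | x 2 = 0} := isClosed_eq (by fun_prop) (by fun_prop)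
  have hB := hP.inter_right hc
  obtain ⟨x0, hx0, hx02⟩ := h0
  obtain ⟨b, hb, hmax⟩ := hB.exists_isMaxOn (f := fun x : Fin 3 → ℝ => p * x 0 + r * x 1) ⟨x0, hx0, hx02⟩
    (by fun_prop)
  set M := (convexHull ℝ S ∩ {x : Fin 3 → ℝ | x 2 = 0}) ∩ {x : Fin 3 → ℝ | p * x 0 + r * x 1 = p * b 0 + r * b 1} with hM
  have hMc : IsCompact M := hB.inter_right (isClosed_eq (by fun_prop) (by fun_prop))
  obtain ⟨v, hv⟩ := hMc.extremePoints_nonempty ⟨b, hb, rfl⟩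
  have hext : IsExtreme ℝ (convexHull ℝ S) M := by
    refine ⟨fun x hx => hx.1.1, ?_⟩
    intro x hx y hy z hz hzo
    obtain ⟨a, c, ha, hc, hac, rfl⟩ := hzo
    have z2 : a * x 2 + c * y 2 = 0 := by simpa using hz.1.2
    have hx2 := hh x hx
    have hy2 := hh y hy
    have q1 := mul_nonneg ha.le hx2
    have q2 := mul_nonneg hc.le hy2
    have x2 : x 2 = 0 := (mul_eq_zero.mp (by linarith : a * x 2 = 0)).resolve_left ha.ne'
    have y2 : y 2 = 0 := (mul_eq_zero.mp (by linarith : c * y 2 = 0)).resolve_left hc.ne'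
    have mx : p * x 0 + r * x 1 ≤ p * b 0 + r * b 1 := hmax ⟨hx, x2⟩
    have my : p * y 0 + r * y 1 ≤ p * b 0 + r * b 1 := hmax ⟨hy, y2⟩
    have hz2 : p * (a * x 0 + c * y 0) + r * (a * x 1 + c * y 1) = p * b 0 + r * b 1 := by simpa using hz.2
    refine ⟨⟨hx, x2⟩, le_antisymm mx ?_⟩
    have h1 := mul_nonneg hc.le (sub_nonneg.mpr my)
    have h2 : a * (p * b 0 + r * b 1 - (p * x 0 + r * x 1)) ≤ 0 := by
      have : a = 1 - c := by linarith
      subst this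
      linarith
    by_contra hcon
    push Not at hcon
    have := mul_pos ha (sub_pos.mpr hcon)
    linarith
  refine ⟨v, hext.extremePoints_subset_extremePoints hv, hv.1.1.2, ?_⟩
  intro x hx hx2
  have := hv.1.2
  simp only [Set.mem_setOf_eq] at this
  rw [this]
  exact hmax ⟨hx, hx2⟩


theorem height_hull (S : Set (Fin 3 → ℝ)) (k : ℕ)
    (hSint : ∀ s ∈ S, ∃ n : Fin 3 → ℤ, toR3 n = s ∧ (n 2 = 0 ∨ n 2 = (k : ℤ)))
    (x : Fin 3 → ℝ) (hx : x ∈ convexHull ℝ S) : 0 ≤ x 2 ∧ x 2 ≤ k := by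
  have hc : Convex ℝ {x : Fin 3 → ℝ | 0 ≤ x 2 ∧ x 2 ≤ k} := by
    intro x hx y hy a b ha hb hab
    simp only [Set.mem_setOf_eq, Pi.add_apply, Pi.smul_apply, smul_eq_mul] at *
    have h1 := mul_nonneg ha hx.1
    have h2 := mul_nonneg hb hy.1
    have h3 := mul_nonneg ha (sub_nonneg.mpr hx.2)
    have h4 := mul_nonneg hb (sub_nonneg.mpr hy.2)
    refine ⟨by linarith, ?_⟩
    have : (k : ℝ) = a * k + b * k := by rw [← add_mul, hab, one_mul]
    linarith
  refine convexHull_min ?_ hc hx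
  intro s hs
  obtain ⟨n, rfl, h | h⟩ := hSint s hs
  · simp [toR3, h]
  · simp [toR3, h]

theorem prism_struct (S : Set (Fin 3 → ℝ)) (hS : S.Finite) (k : ℕ) (hk : 0 < k)
    (hSint : ∀ s ∈ S, ∃ n : Fin 3 → ℤ, toR3 n = s ∧ (n 2 = 0 ∨ n 2 = (k : ℤ)))
    (nc0 : ∀ p r C : ℝ, (∀ x ∈ convexHull ℝ S, x 2 = 0 → p * x 0 + r * x 1 = C) → p = 0 ∧ r = 0)
    (nck : ∀ p r C : ℝ, (∀ x ∈ convexHull ℝ S, x 2 = k → p * x 0 + r * x 1 = C) → p = 0 ∧ r = 0)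
    (hsm : IsSmooth (convexHull ℝ S)) :
    ∃ (ι : Type) (_ : Fintype ι) (_ : Nonempty ι) (n δ : ι → Fin 3 → ℤ),
      (∀ i (c : ℝ), 0 ≤ c → c ≤ k → ![n i 0 + c * δ i 0, n i 1 + c * δ i 1, c] ∈ convexHull ℝ S) ∧
      (∀ c : ℤ, 0 < c → c ≤ k → ∀ i j, n i 0 + c * δ i 0 = n j 0 + c * δ j 0 →
        n i 1 + c * δ i 1 = n j 1 + c * δ j 1 → i = j) ∧
      (∀ p r : ℝ, ∃ i, ∀ x ∈ convexHull ℝ S, x 2 = 0 → p * x 0 + r * x 1 ≤ p * n i 0 + r * n i 1) ∧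
      (∀ i (p r : ℝ), (∀ x ∈ convexHull ℝ S, x 2 = 0 → p * x 0 + r * x 1 ≤ p * n i 0 + r * n i 1) →
        ∀ x ∈ convexHull ℝ S, p * x 0 + r * x 1 ≤ p * n i 0 + r * n i 1 + (p * δ i 0 + r * δ i 1) * x 2) := by
  have hH := height_hull S k hSint
  have hkR : (0 : ℝ) < k := by exact_mod_cast hk
  have hES : (convexHull ℝ S).extremePoints ℝ ⊆ S := extremePoints_convexHull_subset
  have hne0 : ∃ x ∈ convexHull ℝ S, x 2 = 0 := by
    by_contra hcon
    push Not at hcon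
    have := nc0 1 0 0 (fun x hx h => absurd h (hcon x hx))
    exact one_ne_zero this.1
  have hfm := face_max S hS (fun x hx => (hH x hx).1) hne0
  let ι := {v : Fin 3 → ℝ // v ∈ (convexHull ℝ S).extremePoints ℝ ∧ v 2 = 0}
  have hfin : Finite ι := (hS.subset (fun v (hv : v ∈ (convexHull ℝ S).extremePoints ℝ ∧ v 2 = 0) => hES hv.1)).to_subtype
  have hf : Fintype ι := Fintype.ofFinite ι
  have hnon : Nonempty ι := by
    obtain ⟨v, hv, hv2, _⟩ := hfm 0 0
    exact ⟨⟨v, hv, hv2⟩⟩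
  have VS : ∀ i : ι, _ := fun i => vertex_struct S hS hsm i.1 i.2.1 1 (Or.inl rfl)
    (by intro x hx; rw [i.2.2]; simpa using (hH x hx).1)
    (by rw [i.2.2]; exact nc0)
  choose δ t hδ ht hedge huniq hmp using VS
  have hn : ∀ i : ι, ∃ n : Fin 3 → ℤ, toR3 n = i.1 := fun i => by
    obtain ⟨n, h, _⟩ := hSint i.1 (hES i.2.1)
    exact ⟨n, h⟩
  choose n hn using hn
  have hn0 : ∀ (i : ι) l, i.1 l = (n i l : ℝ) := fun i l => by rw [← hn i]; rfl
  have hwE : ∀ i : ι, i.1 + t i • toR3 (δ i) ∈ (convexHull ℝ S).extremePoints ℝ := fun i =>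
    right_ext (hedge i).2 (hedge i).1
  have htk : ∀ i, t i = k := by
    intro i
    obtain ⟨m, hm, hm2⟩ := hSint _ (hES (hwE i))
    have h2 := congrFun hm 2
    simp only [toR3, Pi.add_apply, Pi.smul_apply, smul_eq_mul, i.2.2, hδ] at h2
    have := ht i
    rcases hm2 with h | h
    · rw [h] at h2; simp at h2; linarith
    · rw [h] at h2; simp at h2; linarith
  have hseg : ∀ (i : ι) (c : ℝ), 0 ≤ c → c ≤ k → ![n i 0 + c * δ i 0, n i 1 + c * δ i 1, c] ∈ segment ℝ i.1 (i.1 + t i • toR3 (δ i)) := by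
    intro i c h0 h1
    rw [segment_eq_image']
    refine ⟨c / k, ⟨by positivity, by rw [div_le_one hkR]; exact h1⟩, ?_⟩
    ext l
    have h2 := i.2.2
    have h3 := hδ i
    fin_cases l
    · simp [hn0, toR3, htk]; field_simp
    · simp [hn0, toR3, htk]; field_simp
    · simp [h2, h3, toR3, htk]; field_simp
  have hmem : ∀ (i : ι) (c : ℝ), 0 ≤ c → c ≤ k → ![n i 0 + c * δ i 0, n i 1 + c * δ i 1, c] ∈ convexHull ℝ S :=
    fun i c h0 h1 => (hedge i).2.subset (hseg i c h0 h1)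
  refine ⟨ι, hf, hnon, n, δ, hmem, ?_, ?_, ?_⟩
  · intro c hc0 hck i j e0 e1
    have hc0R : (0:ℝ) < c := by exact_mod_cast hc0
    have hckR : (c:ℝ) ≤ k := by exact_mod_cast hck
    have e0R : (n i 0 + c * δ i 0 : ℝ) = n j 0 + c * δ j 0 := by exact_mod_cast e0
    have e1R : (n i 1 + c * δ i 1 : ℝ) = n j 1 + c * δ j 1 := by exact_mod_cast e1
    rcases hck.lt_or_eq with hlt | heq
    · have hltR : (c:ℝ) < k := by exact_mod_cast hlt
      have q1 := hseg i c hc0R.le hckR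
      have q2 : (![n i 0 + (c:ℝ) * δ i 0, n i 1 + (c:ℝ) * δ i 1, (c:ℝ)] : Fin 3 → ℝ) ∈ openSegment ℝ j.1 (j.1 + t j • toR3 (δ j)) := by
        rw [e0R, e1R, openSegment_eq_image']
        refine ⟨c / k, ⟨by positivity, by rw [div_lt_one hkR]; exact hltR⟩, ?_⟩
        ext l
        have h2 := j.2.2
        have h3 := hδ j
        fin_cases l
        · simp [hn0, toR3, htk]; field_simp
        · simp [hn0, toR3, htk]; field_simp
        · simp [h2, h3, toR3, htk]; field_simp
      have q3 := (hedge i).2.left_mem_of_mem_openSegment j.2.1.1 (hwE j).1 q1 q2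
      rw [segment_eq_image'] at q3
      obtain ⟨θ, _, hθ⟩ := q3
      have h2 := congrFun hθ 2
      simp [toR3, i.2.2, j.2.2, hδ] at h2
      have hθ0 : θ = 0 := h2.resolve_right (ht i).ne'
      apply Subtype.ext
      rw [← hθ, hθ0]; simp
    · have hckk : (c:ℝ) = k := by exact_mod_cast heq
      have hw : i.1 + t i • toR3 (δ i) = j.1 + t j • toR3 (δ j) := by
        rw [hckk] at e0R e1R
        ext l
        fin_cases l
        · simp [hn0, toR3, htk]; linarith
        · simp [hn0, toR3, htk]; linarith
        · simp [i.2.2, j.2.2, hδ, toR3, htk]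
      have hw2 : (i.1 + t i • toR3 (δ i)) 2 = k := by simp [i.2.2, hδ, toR3, htk]
      obtain ⟨δ', t', _, _, _, hu, _⟩ := vertex_struct S hS hsm _ (hwE i) (-1) (Or.inr rfl)
        (by intro x hx; rw [hw2]; have := (hH x hx).2; push_cast; linarith)
        (by rw [hw2]; exact nck)
      have a1 := hu i.1 ⟨(hedge i).1.symm, by rw [segment_symm]; exact (hedge i).2⟩
        (by rw [hw2, i.2.2]; exact hkR.ne)
      have a2 := hu j.1 ⟨by rw [hw]; exact (hedge j).1.symm, by rw [hw, segment_symm]; exact (hedge j).2⟩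
        (by rw [hw2, j.2.2]; exact hkR.ne)
      exact Subtype.ext (a1.trans a2.symm)
  · intro p r
    obtain ⟨v, hv, hv2, hm⟩ := hfm p r
    refine ⟨⟨v, hv, hv2⟩, ?_⟩
    intro x hx hx2
    rw [← hn0, ← hn0]
    exact hm x hx hx2
  · intro i p r h x hx
    have := hmp i p r (by
      intro x hx hx2
      rw [hn0, hn0]; rw [i.2.2] at hx2
      exact h x hx hx2) x hx
    rw [hn0, hn0, i.2.2] at this
    simpa using this


theorem sep3 (C : Set (Fin 3 → ℝ)) (hC : Convex ℝ C) (hcl : IsClosed C) (x : Fin 3 → ℝ)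
    (h : ∀ p r s : ℝ, ∃ y ∈ C, p * x 0 + r * x 1 + s * x 2 ≤ p * y 0 + r * y 1 + s * y 2) : x ∈ C := by
  by_contra hx
  obtain ⟨f, u, h1, h2⟩ := geometric_hahn_banach_closed_point hC hcl hx
  have hf : ∀ y : Fin 3 → ℝ, f y = f (Pi.single 0 1) * y 0 + f (Pi.single 1 1) * y 1 + f (Pi.single 2 1) * y 2 := by
    intro y
    have : y = y 0 • Pi.single 0 1 + y 1 • Pi.single 1 1 + y 2 • Pi.single 2 1 := by
      ext l; fin_cases l <;> simp
    conv_lhs => rw [this]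
    simp only [map_add, map_smul, smul_eq_mul]
    ring
  obtain ⟨y, hy, hle⟩ := h (f (Pi.single 0 1)) (f (Pi.single 1 1)) (f (Pi.single 2 1))
  rw [← hf, ← hf] at hle
  have := h1 y hy
  linarith

theorem wts {κ : Type} [Fintype κ] (g : κ → Fin 3 → ℝ) (x : Fin 3 → ℝ) (hx : x ∈ convexHull ℝ (Set.range g)) :
    ∃ w : κ → ℝ, (∀ i, 0 ≤ w i) ∧ ∑ i, w i = 1 ∧ ∀ l, x l = ∑ i, w i * g i l := by
  classical
  refine convexHull_min (t := {x : Fin 3 → ℝ | ∃ w : κ → ℝ, (∀ i, 0 ≤ w i) ∧ ∑ i, w i = 1 ∧ ∀ l, x l = ∑ i, w i * g i l}) ?_ ?_ hx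
  · rintro _ ⟨i, rfl⟩
    refine ⟨fun j => if j = i then 1 else 0, ?_, ?_, ?_⟩
    · intro j; dsimp only; split_ifs <;> norm_num
    · simp
    · intro l; simp
  · rintro x ⟨w, hw, h1, hx⟩ y ⟨w', hw', h1', hy⟩ a b ha hb hab
    refine ⟨fun i => a * w i + b * w' i, ?_, ?_, ?_⟩
    · intro i
      have := mul_nonneg ha (hw i)
      have := mul_nonneg hb (hw' i)
      dsimp only; linarith
    · rw [Finset.sum_add_distrib, ← Finset.mul_sum, ← Finset.mul_sum, h1, h1']; linarith
    · intro l
      simp only [Pi.add_apply, Pi.smul_apply, smul_eq_mul, hx, hy, Finset.mul_sum, ← Finset.sum_add_distrib]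
      apply Finset.sum_congr rfl
      intro i _; ring

theorem prism_cover (S : Set (Fin 3 → ℝ)) (hS : S.Finite) (k : ℕ) (hk : 0 < k)
    (hSint : ∀ s ∈ S, ∃ n : Fin 3 → ℤ, toR3 n = s ∧ (n 2 = 0 ∨ n 2 = (k : ℤ)))
    (nc0 : ∀ p r C : ℝ, (∀ x ∈ convexHull ℝ S, x 2 = 0 → p * x 0 + r * x 1 = C) → p = 0 ∧ r = 0)
    (nck : ∀ p r C : ℝ, (∀ x ∈ convexHull ℝ S, x 2 = k → p * x 0 + r * x 1 = C) → p = 0 ∧ r = 0)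
    (hsm : IsSmooth (convexHull ℝ S)) : HasUnimodularCover (convexHull ℝ S) := by
  obtain ⟨ι, _, _, n, δ, hmem, hinj, hfm, hmp⟩ := prism_struct S hS k hk hSint nc0 nck hsm
  have hH := height_hull S k hSint
  have hkR : (0 : ℝ) < k := by exact_mod_cast hk
  have hcl : IsClosed (convexHull ℝ S) := (hS.isCompact_convexHull ℝ).isClosed
  have hcv : Convex ℝ (convexHull ℝ S) := convex_convexHull ℝ S
  -- points of slices lie in P
  have hsl : ∀ (c : ℤ) (hc0 : 0 ≤ c) (hck : c ≤ k) (q : Fin 3 → ℤ), q 2 = c →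
      InS (fun i => ((n i 0 + c * δ i 0 : ℤ) : ℝ)) (fun i => ((n i 1 + c * δ i 1 : ℤ) : ℝ)) (q 0) (q 1) →
      toR3 q ∈ convexHull ℝ S := by
    intro c hc0 hck q hq hI
    apply sep3 _ hcv hcl
    intro p r s
    obtain ⟨i, hi⟩ := hI p r
    refine ⟨_, hmem i c (by exact_mod_cast hc0) (by exact_mod_cast hck), ?_⟩
    push_cast at hi
    simp [toR3, hq]
    linarith
  -- maximality at slice propagates to the bottom
  have hbot : ∀ (j : ℤ) (h0 : 0 ≤ j) (hjk : j < k) (p r : ℝ) (i : ι),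
      (∀ l, p * (n l 0 + j * δ l 0) + r * (n l 1 + j * δ l 1) ≤ p * (n i 0 + j * δ i 0) + r * (n i 1 + j * δ i 1)) →
      ∀ x ∈ convexHull ℝ S, x 2 = 0 → p * x 0 + r * x 1 ≤ p * n i 0 + r * n i 1 := by
    intro j h0 hjk p r i hi
    have h0R : (0:ℝ) ≤ j := by exact_mod_cast h0
    have hjkR : (j:ℝ) < k := by exact_mod_cast hjk
    obtain ⟨i', hi'⟩ := hfm p r
    have a1 := hi i'
    have a2 := hi' _ (hmem i 0 le_rfl hkR.le) (by simp)
    have a3 := hmp i' p r hi' _ (hmem i k hkR.le le_rfl)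
    simp at a2 a3
    have key : p * n i' 0 + r * n i' 1 ≤ p * n i 0 + r * n i 1 := by
      set e := p * n i' 0 + r * n i' 1 - (p * n i 0 + r * n i 1) with he
      set D := p * δ i 0 + r * δ i 1 - (p * δ i' 0 + r * δ i' 1) with hD
      have b1 : e ≤ j * D := by rw [he, hD]; linarith
      have b2 : k * D ≤ e := by rw [he, hD]; linarith
      have c1 := mul_le_mul_of_nonneg_left b1 hkR.le
      have c2 := mul_le_mul_of_nonneg_left b2 h0R
      by_contra hcon
      push Not at hcon
      have he' : 0 < e := by rw [he]; linarith
      have c3 := mul_pos (sub_pos.mpr hjkR) he'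
      linarith
    intro x hx hx2
    exact (hi' x hx hx2).trans key
  refine ⟨{T | IsUnimodularTet T ∧ T ⊆ convexHull ℝ S}, fun T hT => hT, ?_⟩
  apply Set.Subset.antisymm
  · exact Set.sUnion_subset fun T hT => hT.2
  intro x hx
  obtain ⟨hx0, hxk⟩ := hH x hx
  obtain ⟨j, hj0, hjk, hjx, hxj⟩ : ∃ j : ℤ, 0 ≤ j ∧ j < k ∧ (j:ℝ) ≤ x 2 ∧ x 2 ≤ j + 1 := by
    rcases hxk.lt_or_eq with h | h
    · refine ⟨⌊x 2⌋, Int.floor_nonneg.mpr hx0, ?_, Int.floor_le _, (Int.lt_floor_add_one _).le⟩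
      have := (Int.floor_le (x 2)).trans_lt h
      exact_mod_cast this
    · refine ⟨k - 1, by omega, by omega, ?_, ?_⟩
      · push_cast; linarith
      · push_cast; linarith
  set bx : ι → ℤ := fun i => n i 0 + j * δ i 0 with hbx
  set b_y : ι → ℤ := fun i => n i 1 + j * δ i 1 with hby
  set ax : ι → ℤ := fun i => n i 0 + (j + 1) * δ i 0 with hax
  set ay : ι → ℤ := fun i => n i 1 + (j + 1) * δ i 1 with hay
  have hconv : x ∈ convexHull ℝ (Set.range (Sum.elim (fun i => (![(bx i : ℝ), (b_y i : ℝ), (j:ℝ)] : Fin 3 → ℝ))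
      (fun i => (![(ax i : ℝ), (ay i : ℝ), ((j:ℝ)+1)] : Fin 3 → ℝ)))) := by
    apply sep3 _ (convex_convexHull ℝ _) ((Set.finite_range _).isCompact_convexHull ℝ).isClosed
    intro p r s
    obtain ⟨i, hi⟩ := hfm p r
    have h1 := hmp i p r hi x hx
    set G := p * δ i 0 + r * δ i 1 + s with hG
    rcases le_total 0 G with h | h
    · refine ⟨_, subset_convexHull ℝ _ ⟨Sum.inr i, rfl⟩, ?_⟩
      have := mul_nonneg h (sub_nonneg.mpr hxj)
      rw [hG] at this
      simp [hax, hay]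
      linarith
    · refine ⟨_, subset_convexHull ℝ _ ⟨Sum.inl i, rfl⟩, ?_⟩
      have := mul_nonneg (neg_nonneg.mpr h) (sub_nonneg.mpr hjx)
      rw [hG] at this
      simp [hbx, hby]
      linarith
  obtain ⟨w, hw, hw1, hwx⟩ := wts _ x hconv
  rw [Fintype.sum_sum_type] at hw1
  have e0 := hwx 0
  have e1 := hwx 1
  have e2 := hwx 2
  rw [Fintype.sum_sum_type] at e0 e1 e2
  simp at e0 e1 e2
  obtain ⟨v, hv, hdet, hxv⟩ := slab ax ay bx b_y (by
      intro p r i hi l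
      have h1 := hmp i p r (hbot j hj0 hjk p r i (by
        intro l
        have := hi l
        simp only [hbx, hby] at this
        push_cast at this
        exact this)) _ (hmem l (j+1) (by have : (0:ℝ) ≤ j := by exact_mod_cast hj0
                                         linarith) (by exact_mod_cast hjk))
      simp at h1
      simp [hax, hay]
      linarith)
    (by
      intro i l h0 h1
      exact hinj (j+1) (by omega) (by omega) i l h0 h1)
    (by
      intro p r hc
      have i0 : ι := Classical.arbitrary ι
      have hc' : ∀ l, p * (n l 0 + j * δ l 0) + r * (n l 1 + j * δ l 1) = p * (n i0 0 + j * δ i0 0) + r * (n i0 1 + j * δ i0 1) := by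
        intro l
        have := hc l i0
        simp only [hbx, hby] at this
        push_cast at this
        exact this
      have u1 := hbot j hj0 hjk p r i0 (fun l => (hc' l).le)
      have u2 := hbot j hj0 hjk (-p) (-r) i0 (fun l => by have := hc' l; linarith)
      apply nc0 p r (p * n i0 0 + r * n i0 1)
      intro x hx hx2
      have := u1 x hx hx2
      have := u2 x hx hx2
      linarith)
    j (x 0) (x 1) (x 2) (fun i => w (Sum.inl i)) (fun i => w (Sum.inr i))
    (fun i => hw _) (fun i => hw _) e0 e1 (by rw [e2]) hw1
  have hvP : ∀ i, toR3 (v i) ∈ convexHull ℝ S := by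
    intro i
    rcases hv i with ⟨h2, hI⟩ | ⟨h2, hI⟩
    · exact hsl j hj0 hjk.le (v i) h2 hI
    · exact hsl (j+1) (by omega) (by omega) (v i) h2 hI
  refine ⟨convexHull ℝ {toR3 (v 0), toR3 (v 1), toR3 (v 2), toR3 (v 3)}, ⟨⟨v, rfl, ?_⟩, ?_⟩, ?_⟩
  · exact hdet
  · apply convexHull_min _ hcv
    rintro y (rfl | rfl | rfl | rfl) <;> exact hvP _
  · have : x = ![x 0, x 1, x 2] := by ext l; fin_cases l <;> rfl
    rw [this]
    exact hxv


theorem snoc_hull (h : ℝ) (A : Set (Fin 2 → ℝ)) (T : Set (Fin 3 → ℝ)) (hT : Convex ℝ T)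
    (hA : ∀ a ∈ A, (Fin.snoc a h : Fin 3 → ℝ) ∈ T) :
    ∀ x ∈ convexHull ℝ A, (Fin.snoc x h : Fin 3 → ℝ) ∈ T := by
  have hc : Convex ℝ {x : Fin 2 → ℝ | (Fin.snoc x h : Fin 3 → ℝ) ∈ T} := by
    intro x hx y hy a b ha hb hab
    have h1 := hT hx hy ha hb hab
    have h2 : (Fin.snoc (a • x + b • y) h : Fin 3 → ℝ) = a • (Fin.snoc x h : Fin 3 → ℝ) + b • (Fin.snoc y h : Fin 3 → ℝ) := by
      ext l
      fin_cases l
      · simp [Fin.snoc]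
      · simp [Fin.snoc]
      · simp [Fin.snoc]; rw [← add_mul, hab, one_mul]
    show (Fin.snoc (a • x + b • y) h : Fin 3 → ℝ) ∈ T
    rw [h2]; exact h1
  exact fun x hx => convexHull_min hA hc hx

theorem nc_of_span (Q : Set (Fin 2 → ℝ)) (hQ : affineSpan ℝ Q = ⊤) (p r C : ℝ)
    (h : ∀ x ∈ Q, p * x 0 + r * x 1 = C) : p = 0 ∧ r = 0 := by
  have key : ∀ x : Fin 2 → ℝ, p * x 0 + r * x 1 = C := by
    intro x
    have hx : x ∈ affineSpan ℝ Q := by rw [hQ]; trivial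
    refine affineSpan_induction (p := fun x : Fin 2 → ℝ => p * x 0 + r * x 1 = C) hx h ?_
    intro c u v w hu hv hw
    simp only [vsub_eq_sub, vadd_eq_add, Pi.add_apply, Pi.smul_apply, Pi.sub_apply, smul_eq_mul]
    linear_combination c * hu - c * hv + hw
  have k0 := key ![0, 0]
  have k1 := key ![1, 0]
  have k2 := key ![0, 1]
  simp at k0 k1 k2
  exact ⟨by linarith, by linarith⟩

/-- Every smooth 3-dimensional lattice prismatoid
`P = conv(Q₁×{0} ∪ Q₂×{k})` has a unimodular cover. -/
theorem smooth_prismatoid_has_unimodular_cover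
    (Q₁ Q₂ : Set (Fin 2 → ℝ))
    (hQ₁ : IsLatticePolytope2 Q₁) (hQ₁dim : affineSpan ℝ Q₁ = ⊤)
    (hQ₂ : IsLatticePolytope2 Q₂) (hQ₂dim : affineSpan ℝ Q₂ = ⊤)
    (k : ℕ) (hk : 0 < k)
    (P : Set (Fin 3 → ℝ))
    (hPdef : P = convexHull ℝ
      ((fun x => Fin.snoc x (0:ℝ)) '' Q₁ ∪ (fun x => Fin.snoc x (k:ℝ)) '' Q₂))
    (hdim : affineSpan ℝ P = ⊤)
    (hsmooth : IsSmooth P) :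
    HasUnimodularCover P := by
  obtain ⟨V1, _, h1⟩ := hQ₁
  obtain ⟨V2, _, h2⟩ := hQ₂
  set S : Set (Fin 3 → ℝ) := (fun x : Fin 2 → ℝ => (Fin.snoc x (0:ℝ) : Fin 3 → ℝ)) '' (toR2 '' ↑V1) ∪
    (fun x : Fin 2 → ℝ => (Fin.snoc x (k:ℝ) : Fin 3 → ℝ)) '' (toR2 '' ↑V2) with hSdef
  have m1 : ∀ x ∈ Q₁, (Fin.snoc x (0:ℝ) : Fin 3 → ℝ) ∈ convexHull ℝ S := by
    rw [h1]
    exact snoc_hull 0 _ _ (convex_convexHull ℝ S)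
      (fun a ha => subset_convexHull ℝ S (Or.inl ⟨a, ha, rfl⟩))
  have m2 : ∀ x ∈ Q₂, (Fin.snoc x (k:ℝ) : Fin 3 → ℝ) ∈ convexHull ℝ S := by
    rw [h2]
    exact snoc_hull k _ _ (convex_convexHull ℝ S)
      (fun a ha => subset_convexHull ℝ S (Or.inr ⟨a, ha, rfl⟩))
  have hPS : P = convexHull ℝ S := by
    rw [hPdef]
    apply Set.Subset.antisymm
    · apply convexHull_min _ (convex_convexHull ℝ S)
      rintro _ (⟨x, hx, rfl⟩ | ⟨x, hx, rfl⟩)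
      · exact m1 x hx
      · exact m2 x hx
    · apply convexHull_mono
      apply Set.union_subset_union
      · apply Set.image_mono
        rw [h1]; exact subset_convexHull ℝ _
      · apply Set.image_mono
        rw [h2]; exact subset_convexHull ℝ _
  rw [hPS] at hsmooth ⊢
  have hfin : S.Finite := by
    apply Set.Finite.union
    · exact ((V1.finite_toSet).image _).image _
    · exact ((V2.finite_toSet).image _).image _
  refine prism_cover S hfin k hk ?_ ?_ ?_ hsmooth
  · rintro s (⟨_, ⟨v, hv, rfl⟩, rfl⟩ | ⟨_, ⟨v, hv, rfl⟩, rfl⟩)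
    · refine ⟨![v 0, v 1, 0], ?_, Or.inl rfl⟩
      ext l; fin_cases l <;> simp [toR3, toR2, Fin.snoc]
    · refine ⟨![v 0, v 1, k], ?_, Or.inr rfl⟩
      ext l; fin_cases l <;> simp [toR3, toR2, Fin.snoc]
  · intro p r C h
    apply nc_of_span Q₁ hQ₁dim p r C
    intro x hx
    have := h _ (m1 x hx) (by simp [Fin.snoc])
    simpa [Fin.snoc] using this
  · intro p r C h
    apply nc_of_span Q₂ hQ₂dim p r C
    intro x hx
    have := h _ (m2 x hx) (by simp [Fin.snoc])
    simpa [Fin.snoc] using this
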